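/- arXiv:2201.06184 — 2 statements merged into one kernel-verified Lean document; each statement's English description precedes it below -/
import Mathlib

section
/- Let c be a real number and suppose c < 1 + ω ≤ 2, where ω = sup{Re(s) : ζ(s) = 0}. Then for every δ > 0 there is a constant K > 0 such that there are arbitrarily large x with ∫_2^x (Π(t) − li(t))/t^c dt > K·x^{1+ω−c−δ}, and also arbitrarily large x with ∫_2^x (Π(t) − li(t))/t^c dt < −K·x^{1+ω−c−δ}. -/
open MeasureTheory Filter

/-- `PiR x = ∑_{p^m ≤ x} 1/m`, the Riemann prime-counting function
(sum over prime powers `p^m ≤ x` with `m ≥ 1`). -/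
noncomputable def PiR (x : ℝ) : ℝ :=
  ∑ n ∈ Finset.Icc 1 ⌊x⌋₊,
    if IsPrimePow n then (1 : ℝ) / (n.factorization n.minFac) else 0

/-- `li x` is the logarithmic integral, defined for `x > 1` as the Cauchy principal value
`lim_{ε→0⁺} (∫_0^{1-ε} du/log u + ∫_{1+ε}^x du/log u)`. -/
noncomputable def li (x : ℝ) : ℝ :=
  limUnder (nhdsWithin (0:ℝ) (Set.Ioi 0)) (fun ε =>
    (∫ u in (0:ℝ)..(1 - ε), 1 / Real.log u) + ∫ u in (1 + ε)..x, 1 / Real.log u)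

/-- `omegaZ = sup {Re s : ζ(s) = 0}`. -/
noncomputable def omegaZ : ℝ := sSup {r : ℝ | ∃ s : ℂ, riemannZeta s = 0 ∧ s.re = r}

/-- `ξ`-like entire function. -/
noncomputable def xiE (s : ℂ) : ℂ := s * (s - 1) * completedRiemannZeta₀ s + 1

lemma xiE_diff : Differentiable ℂ xiE := by
  unfold xiE
  have := differentiable_completedZeta₀
  fun_prop

lemma xiE_one_sub (s : ℂ) : xiE (1 - s) = xiE s := by
  unfold xiE
  rw [completedRiemannZeta₀_one_sub]; ring

lemma xiE_eq {s : ℂ} (h0 : s ≠ 0) (h1 : s ≠ 1) :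
    xiE s = s * (s - 1) * completedRiemannZeta s := by
  unfold xiE
  rw [completedRiemannZeta_eq]
  have : 1 - s ≠ 0 := sub_ne_zero.mpr h1.symm
  field_simp
  ring

lemma completed₀_bounded (a b : ℝ) : ∃ C : ℝ, ∀ s : ℂ, a ≤ s.re → s.re ≤ b →
    ‖completedRiemannZeta₀ s‖ ≤ C := by
  let P := HurwitzZeta.hurwitzEvenFEPair 0
  have hconv : ∀ z : ℂ, MellinConvergent P.f_modif z := fun z =>
    (P.isStrongFEPair_toStrongFEPair.hasMellin z).1
  refine ⟨(∫ t in Set.Ioi (0:ℝ), (‖(t:ℂ) ^ ((a/2:ℝ) - 1 : ℂ) • P.f_modif t‖ +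
    ‖(t:ℂ) ^ ((b/2:ℝ) - 1 : ℂ) • P.f_modif t‖)) / 2, fun s ha hb => ?_⟩
  have e : completedRiemannZeta₀ s = mellin P.f_modif (s/2) / 2 := rfl
  rw [e, norm_div, Complex.norm_ofNat]
  gcongr
  unfold mellin
  refine (norm_integral_le_integral_norm _).trans ?_
  refine setIntegral_mono_on (hconv (s/2)).norm ((hconv _).norm.add (hconv _).norm)
    measurableSet_Ioi ?_
  intro t ht
  have ht : 0 < t := ht
  simp only [norm_smul, ← add_mul]
  gcongr
  simp only [Complex.norm_cpow_eq_rpow_re_of_pos ht, Complex.sub_re, Complex.ofReal_re,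
    Complex.one_re, Complex.div_ofNat_re]
  rcases le_total 1 t with h | h
  · have := Real.rpow_le_rpow_of_exponent_le h (show s.re/2 - 1 ≤ b/2 - 1 by linarith)
    have := Real.rpow_nonneg ht.le (a/2-1)
    linarith
  · have := Real.rpow_le_rpow_of_exponent_ge ht h (show a/2 - 1 ≤ s.re/2 - 1 by linarith)
    have := Real.rpow_nonneg ht.le (b/2-1)
    linarith

lemma norm_Gamma_le_re {s : ℂ} (hs : 0 < s.re) : ‖Complex.Gamma s‖ ≤ Real.Gamma s.re := by
  rw [Complex.Gamma_eq_integral hs, Real.Gamma_eq_integral hs, Complex.GammaIntegral]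
  refine (norm_integral_le_integral_norm _).trans (le_of_eq ?_)
  refine setIntegral_congr_fun measurableSet_Ioi fun t ht => ?_
  have ht : 0 < t := ht
  simp only [norm_mul, Complex.norm_cpow_eq_rpow_re_of_pos ht, Complex.norm_real]
  simp [abs_of_pos (Real.exp_pos _)]

lemma completed_bound_right : ∃ C : ℝ, 0 ≤ C ∧ ∀ s : ℂ, 4 ≤ s.re →
    ‖completedRiemannZeta s‖ ≤ C * Real.Gamma (s.re / 2) := by
  refine ⟨∑' n : ℕ, 1 / (n : ℝ) ^ 2, by positivity, fun s hs => ?_⟩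
  rw [completedZeta_eq_tsum_of_one_lt_re (by linarith), norm_mul, norm_mul, mul_comm]
  have hsum : Summable fun n : ℕ => 1 / (n : ℝ) ^ 2 := Real.summable_one_div_nat_pow.mpr (by norm_num)
  have hle : ∀ n : ℕ, ‖1 / (n : ℂ) ^ s‖ ≤ 1 / (n : ℝ) ^ 2 := by
    intro n
    rcases Nat.eq_zero_or_pos n with rfl | hn
    · have : s ≠ 0 := by rintro rfl; norm_num at hs
      simp [Complex.zero_cpow this]
    · rw [norm_div, norm_one, Complex.norm_natCast_cpow_of_pos hn]
      have h1 : (1:ℝ) ≤ n := by exact_mod_cast hn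
      have := Real.rpow_le_rpow_of_exponent_le h1 (show (2:ℝ) ≤ s.re by linarith)
      rw [Real.rpow_two] at this
      exact one_div_le_one_div_of_le (by positivity) this
  gcongr
  · exact tsum_of_norm_bounded hsum.hasSum hle
  · have h1 : ‖(Real.pi : ℂ) ^ (-s / 2)‖ ≤ 1 := by
      rw [Complex.norm_cpow_eq_rpow_re_of_pos Real.pi_pos]
      apply Real.rpow_le_one_of_one_le_of_nonpos
      · linarith [Real.pi_gt_three]
      · simp; linarith
    have h2 : ‖Complex.Gamma (s / 2)‖ ≤ Real.Gamma (s.re / 2) := by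
      have := norm_Gamma_le_re (s := s / 2) (by simp; linarith)
      simpa using this
    calc _ ≤ 1 * Real.Gamma (s.re / 2) := by gcongr
      _ = _ := one_mul _

lemma Gamma_bound {x : ℝ} (hx : 2 ≤ x) :
    Real.Gamma x ≤ Real.exp (2 * (x + 1) * Real.sqrt (x + 1)) := by
  set n := ⌈x⌉₊ with hn
  have h1 : x ≤ n := Nat.le_ceil x
  have h2 : (n : ℝ) < x + 1 := Nat.ceil_lt_add_one (by linarith)
  have hn0 : (0:ℝ) < n := by linarith
  have h3 : Real.Gamma x ≤ Real.Gamma (n + 1) :=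
    Real.Gamma_strictMonoOn_Ici.monotoneOn hx (by simp; linarith) (by linarith)
  rw [Real.Gamma_nat_eq_factorial] at h3
  have h4 : (n.factorial : ℝ) ≤ (n : ℝ) ^ n := by exact_mod_cast Nat.factorial_le_pow n
  refine h3.trans (h4.trans ?_)
  rw [← Real.exp_log (pow_pos hn0 n), Real.log_pow]
  apply Real.exp_le_exp.mpr
  have h5 : Real.log n ≤ 2 * Real.sqrt n := by
    have := Real.log_le_sub_one_of_pos (Real.sqrt_pos.mpr hn0)
    rw [Real.log_sqrt hn0.le] at this
    linarith
  calc (n:ℝ) * Real.log n ≤ n * (2 * Real.sqrt n) := by gcongr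
    _ ≤ (x+1) * (2 * Real.sqrt (x+1)) := by gcongr
    _ = _ := by ring

lemma xiE_bound : ∃ C : ℝ, 0 < C ∧ ∀ R : ℝ, 1 ≤ R → ∀ s : ℂ, ‖s‖ ≤ R →
    ‖xiE s‖ ≤ Real.exp (C * (R * Real.sqrt R)) := by
  obtain ⟨C1, h1⟩ := completed₀_bounded 0 4
  obtain ⟨C2, h20, h2⟩ := completed_bound_right
  have key : ∃ C : ℝ, 0 < C ∧ ∀ R : ℝ, 2 ≤ R → ∀ s : ℂ, ‖s‖ ≤ R → 0 ≤ s.re →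
      ‖xiE s‖ ≤ Real.exp (C * (R * Real.sqrt R)) := by
    refine ⟨|C1| + C2 + 10, by positivity, fun R hR s hs hre => ?_⟩
    have hR1 : 1 ≤ Real.sqrt R := by rw [Real.one_le_sqrt]; linarith
    have hpoly : ‖s * (s - 1)‖ ≤ R * (R + 1) := by
      rw [norm_mul]; gcongr
      exact (norm_sub_le _ _).trans (by simpa using hs)
    have hRR : R ≤ R * Real.sqrt R := by nlinarith
    have hRe : R * (R + 1) ≤ Real.exp (2 * R) := by
      have := Real.add_one_le_exp R
      have h3 : Real.exp (2 * R) = Real.exp R * Real.exp R := by rw [← Real.exp_add]; ring_nf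
      rw [h3]; gcongr <;> linarith
    rcases le_total s.re 4 with h4 | h4
    · have hb : ‖xiE s‖ ≤ R * (R+1) * |C1| + 1 := by
        unfold xiE
        refine (norm_add_le _ _).trans ?_
        rw [norm_one, norm_mul]
        gcongr
        exact (h1 s hre h4).trans (le_abs_self _)
      calc _ ≤ R * (R+1) * |C1| + 1 := hb
        _ ≤ Real.exp (2 * R) * (|C1| + 1) := by
          have : 1 ≤ Real.exp (2*R) := Real.one_le_exp (by linarith)
          have := mul_le_mul_of_nonneg_right hRe (abs_nonneg C1)
          linarith
        _ ≤ Real.exp (2 * R) * Real.exp |C1| := by gcongr; exact Real.add_one_le_exp _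
        _ = Real.exp (2 * R + |C1|) := by rw [Real.exp_add]
        _ ≤ _ := by
          apply Real.exp_le_exp.mpr
          nlinarith [abs_nonneg C1]
    · have e := xiE_eq (s := s) (by rintro rfl; norm_num at h4) (by rintro rfl; norm_num at h4)
      have hsR : s.re ≤ R := (Complex.re_le_norm s).trans hs
      have hG : Real.Gamma (s.re/2) ≤ Real.exp (2 * (R * Real.sqrt R)) := by
        refine (Gamma_bound (by linarith)).trans (Real.exp_le_exp.mpr ?_)
        rw [mul_assoc]
        gcongr <;> linarith
      calc ‖xiE s‖ = ‖s * (s-1)‖ * ‖completedRiemannZeta s‖ := by rw [e, norm_mul]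
        _ ≤ (R * (R+1)) * (C2 * Real.Gamma (s.re/2)) := by gcongr; exact h2 s h4
        _ ≤ Real.exp (2*R) * (Real.exp C2 * Real.exp (2 * (R * Real.sqrt R))) := by
          gcongr
          linarith [Real.add_one_le_exp C2]
        _ = Real.exp (2 * R + (C2 + 2 * (R * Real.sqrt R))) := by rw [Real.exp_add, Real.exp_add]
        _ ≤ _ := by
          apply Real.exp_le_exp.mpr
          nlinarith [abs_nonneg C1]
  obtain ⟨C, hC, h⟩ := key
  refine ⟨8 * C, by positivity, fun R hR s hs => ?_⟩
  have hmain : ‖xiE s‖ ≤ Real.exp (C * ((2*R) * Real.sqrt (2*R))) := by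
    rcases le_total 0 s.re with h0 | h0
    · exact h (2*R) (by linarith) s (by linarith) h0
    · rw [← xiE_one_sub]
      refine h (2*R) (by linarith) (1-s) ?_ (by simp; linarith)
      refine (norm_sub_le _ _).trans ?_
      rw [norm_one]; linarith
  refine hmain.trans (Real.exp_le_exp.mpr ?_)
  have : Real.sqrt (2*R) ≤ 2 * Real.sqrt R := by
    rw [Real.sqrt_mul (by norm_num)]
    gcongr
    rw [Real.sqrt_le_left (by norm_num)]; norm_num
  have h3 : 2 * R * Real.sqrt (2*R) ≤ 2 * R * (2 * Real.sqrt R) := by gcongr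
  have h4 : 0 ≤ R * Real.sqrt R := by positivity
  nlinarith

/-- An entire nowhere vanishing function of order `≤ 3/2` is `a * exp (b z)`. -/
lemma entire_no_zero {F : ℂ → ℂ} (hF : Differentiable ℂ F) (h0 : ∀ z, F z ≠ 0) {C : ℝ}
    (hC : 0 < C) (hb : ∀ R : ℝ, 1 ≤ R → ∀ z, ‖z‖ ≤ R → ‖F z‖ ≤ Real.exp (C * (R * Real.sqrt R))) :
    ∃ b : ℂ, ∀ z, F z = F 0 * Complex.exp (b * z) := by
  have hd : Differentiable ℂ (fun z => deriv F z / F z) := by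
    have := hF.deriv
    exact this.div hF h0
  obtain ⟨H, hH0, hH⟩ := hd.isExactOn_univ.with_val_at 0 0
  have hHd : Differentiable ℂ H := fun z => (hH z (Set.mem_univ _)).differentiableAt
  have hFH : ∀ z, F z = F 0 * Complex.exp (H z) := by
    have hc : ∀ z, HasDerivAt (fun z => F z * Complex.exp (- H z)) 0 z := by
      intro z
      have h1 := (hF z).hasDerivAt.mul ((hH z (Set.mem_univ _)).neg.cexp)
      have h2 : deriv F z * Complex.exp ((-H) z) +
          F z * (Complex.exp ((-H) z) * -(deriv F z / F z)) = 0 := by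
        have := h0 z
        field_simp
        ring
      rw [h2] at h1
      exact h1
    intro z
    have h2 := is_const_of_deriv_eq_zero (fun z => (hc z).differentiableAt)
      (fun z => (hc z).deriv) z 0
    simp only [hH0, neg_zero, Complex.exp_zero, mul_one] at h2
    rw [← h2, mul_assoc, ← Complex.exp_add]; simp
  -- bound for real part
  obtain ⟨D, hD, hre⟩ : ∃ D : ℝ, 0 < D ∧ ∀ R : ℝ, 1 ≤ R → ∀ z, ‖z‖ ≤ R →
      (H z).re ≤ D * (R * Real.sqrt R) := by
    refine ⟨C + |Real.log ‖F 0‖|, by positivity, fun R hR z hz => ?_⟩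
    have h1 := hb R hR z hz
    have hp : 0 < ‖F 0‖ := norm_pos_iff.mpr (h0 0)
    rw [hFH z, norm_mul, Complex.norm_exp, ← Real.exp_log hp, ← Real.exp_add,
      Real.exp_le_exp] at h1
    have h2 := neg_abs_le (Real.log ‖F 0‖)
    have h3 : 1 ≤ R * Real.sqrt R := by
      have : 1 ≤ Real.sqrt R := by rwa [Real.one_le_sqrt]
      nlinarith
    nlinarith [abs_nonneg (Real.log ‖F 0‖)]
  have hnorm : ∀ R : ℝ, 1 ≤ R → ∀ z, ‖z‖ ≤ R → ‖H z‖ ≤ 2 * (D * ((2*R) * Real.sqrt (2*R))) := by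
    intro R hR z hz
    have hs : 0 < Real.sqrt (2*R) := Real.sqrt_pos.mpr (by linarith)
    have := Complex.borelCaratheodory_zero (f := H) (M := D * ((2*R) * Real.sqrt (2*R)))
      (R := 2*R) (z := z) (by positivity) hHd.differentiableOn
      (fun w hw => hre (2*R) (by linarith) w (by simpa using (le_of_lt (by simpa using hw))))
      (by linarith) (by simp; linarith) hH0
    refine this.trans ?_
    rw [div_le_iff₀ (by linarith)]
    have : 0 ≤ 2 * (D * ((2*R) * Real.sqrt (2*R))) := by positivity
    nlinarith
  have hder : ∀ n : ℕ, 2 ≤ n → iteratedDeriv n H 0 = 0 := by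
    intro n hn
    rw [← norm_le_zero_iff]
    have hbd : ∀ R : ℝ, 1 ≤ R → ‖iteratedDeriv n H 0‖ ≤ n.factorial * (8 * D) / Real.sqrt R := by
      intro R hR
      have h1 := Complex.norm_iteratedDeriv_le_of_forall_mem_sphere_norm_le (c := 0) (R := R) n
        (by linarith) hHd.diffContOnCl (fun z hz => hnorm R hR z (by simpa using (le_of_eq (by simpa using hz))))
      refine h1.trans ?_
      have hs : 0 < Real.sqrt R := Real.sqrt_pos.mpr (by linarith)
      rw [mul_div_assoc, mul_div_assoc (n.factorial : ℝ) (8 * D)]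
      refine mul_le_mul_of_nonneg_left ?_ (by positivity)
      rw [div_le_div_iff₀ (by positivity) hs]
      have h2 : Real.sqrt (2*R) ≤ 2 * Real.sqrt R := by
        rw [Real.sqrt_mul (by norm_num)]
        gcongr
        rw [Real.sqrt_le_left (by norm_num)]; norm_num
      have h3 : R ^ 2 ≤ R ^ n := pow_le_pow_right₀ hR hn
      have h4 : Real.sqrt R * Real.sqrt R = R := Real.mul_self_sqrt (by linarith)
      calc 2 * (D * ((2*R) * Real.sqrt (2*R))) * Real.sqrt R
          ≤ 2 * (D * ((2*R) * (2 * Real.sqrt R))) * Real.sqrt R := by gcongr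
        _ = 8 * D * R * (Real.sqrt R * Real.sqrt R) := by ring
        _ = 8 * D * R ^ 2 := by rw [h4]; ring
        _ ≤ _ := by gcongr
    have ht : Tendsto (fun R : ℝ => n.factorial * (8 * D) / Real.sqrt R) atTop (nhds 0) :=
      tendsto_const_nhds.div_atTop Real.tendsto_sqrt_atTop
    exact ge_of_tendsto ht (by filter_upwards [eventually_ge_atTop 1] with R hR using hbd R hR)
  refine ⟨deriv H 0, fun z => ?_⟩
  rw [hFH z]
  congr 2
  rw [← Complex.taylorSeries_eq_of_entire' 0 z hHd]
  rw [tsum_eq_sum (s := {0, 1})]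
  · simp [hH0, iteratedDeriv_one]
  · intro n hn
    have : 2 ≤ n := by
      simp at hn; omega
    rw [hder n this]; simp

lemma exists_nontrivial_zero : ∃ s : ℂ, riemannZeta s = 0 ∧ 1 / 2 ≤ s.re := by
  by_contra hcon
  push Not at hcon
  have hright : ∀ s : ℂ, 1/2 ≤ s.re → xiE s ≠ 0 := by
    intro s hs
    by_cases h1 : s = 1
    · subst h1; simp [xiE]
    have h0 : s ≠ 0 := by rintro rfl; norm_num at hs
    rw [xiE_eq h0 h1]
    have hz : riemannZeta s ≠ 0 := fun h => absurd hs (not_le.mpr (hcon s h))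
    rw [riemannZeta_def_of_ne_zero h0] at hz
    have := (div_ne_zero_iff.mp hz).1
    exact mul_ne_zero (mul_ne_zero h0 (sub_ne_zero.mpr h1)) this
  have hall : ∀ s : ℂ, xiE s ≠ 0 := by
    intro s
    rcases le_total (1/2) s.re with h | h
    · exact hright s h
    · rw [← xiE_one_sub]; apply hright; simp; linarith
  obtain ⟨C, hC, hb⟩ := xiE_bound
  obtain ⟨b, hF⟩ := entire_no_zero (F := xiE) xiE_diff hall hC hb
  have h0 : xiE 0 = 1 := by simp [xiE]
  have h1 : xiE 1 = 1 := by simp [xiE]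
  have hb0 : b = 0 := by
    by_contra hb
    have h2 := xiE_one_sub (1/b)
    rw [hF, hF (1/b), h0, one_mul, one_mul] at h2
    have h3 := hF 1
    rw [h0, h1] at h3
    have e : b * (1 - 1/b) = b * 1 - 1 := by field_simp
    have e' : b * (1/b) = 1 := by field_simp
    rw [e, e', Complex.exp_sub] at h2
    rw [one_mul] at h3
    rw [← h3] at h2
    have h4 : Real.exp (-1) = Real.exp 1 := by
      have : Complex.exp (-1) = Complex.exp 1 := by rw [Complex.exp_neg, ← one_div]; exact h2
      apply Complex.ofReal_injective
      push_cast
      exact this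
    have := Real.exp_injective h4
    norm_num at this
  have h2 : xiE 2 = 1 := by rw [hF, h0, hb0]; simp
  rw [xiE_eq (by norm_num) (by norm_num)] at h2
  have h3 := riemannZeta_def_of_ne_zero (s := 2) (by norm_num)
  rw [riemannZeta_two, Complex.Gammaℝ_def] at h3
  norm_num at h3
  rw [Complex.cpow_neg_one] at h3
  have hpi : (Real.pi : ℂ) ≠ 0 := by exact_mod_cast Real.pi_ne_zero
  have h4 : completedRiemannZeta 2 = 1 / 2 := by linear_combination h2 / 2
  rw [h4] at h3
  field_simp at h3
  have h5 : Real.pi = 3 := by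
    have : (Real.pi : ℂ) = 3 := by linear_combination h3/2
    exact_mod_cast this
  linarith [Real.pi_gt_three]

section Landau
open ProbabilityTheory

lemma landau_core {Ω : Type*} {m : MeasurableSpace Ω} {μ : Measure Ω} {X : Ω → ℝ}
    (hX : ∀ᵐ ω ∂μ, X ω ≤ 0) {σ ε : ℝ} (hε : 0 < ε) (hI : Set.Ioi σ ⊆ integrableExpSet X μ)
    {H : ℂ → ℂ} (hH : DifferentiableOn ℂ H (Metric.ball (σ : ℂ) ε))
    (heq : ∀ s ∈ Metric.ball (σ : ℂ) ε, σ < s.re → complexMGF X μ s = H s) :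
    ∃ τ < σ, τ ∈ integrableExpSet X μ := by
  have hIoiInt : Set.Ioi σ ⊆ interior (integrableExpSet X μ) :=
    interior_maximal hI isOpen_Ioi
  have hXm : AEMeasurable X μ := aemeasurable_of_mem_interior_integrableExpSet
    (hIoiInt (show σ + 1 ∈ Set.Ioi σ by simp))
  set z0 : ℝ := σ + ε with hz0
  have hz0m : z0 ∈ interior (integrableExpSet X μ) := hIoiInt (by simp [hz0, hε])
  set h : ℝ := 6/5 * ε with hh
  set R : ℝ := 5/4 * ε with hR
  classical
  let T : ℂ → ℂ := fun s => if σ < s.re then complexMGF X μ s else H s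
  have hopen : IsOpen {s : ℂ | σ < s.re} := isOpen_lt continuous_const Complex.continuous_re
  have hT1 : ∀ s : ℂ, σ < s.re → T =ᶠ[nhds s] complexMGF X μ := by
    intro s hs
    filter_upwards [hopen.mem_nhds hs] with w hw
    exact if_pos hw
  have hTH : ∀ s ∈ Metric.ball (σ : ℂ) ε, T s = H s := by
    intro s hs
    by_cases h1 : σ < s.re
    · simp only [T, if_pos h1]; exact heq s hs h1
    · simp only [T, if_neg h1]
  have hTd : DifferentiableOn ℂ T (Metric.ball (z0 : ℂ) R) := by
    intro s hs
    apply DifferentiableAt.differentiableWithinAt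
    by_cases h1 : σ < s.re
    · exact (hT1 s h1).differentiableAt_iff.mpr
        (analyticAt_complexMGF (hIoiInt h1)).differentiableAt
    · have hsb : s ∈ Metric.ball (σ : ℂ) ε := by
        simp only [Metric.mem_ball, Complex.dist_eq] at hs ⊢
        have e1 : ‖s - z0‖ ^ 2 = (s.re - z0) ^ 2 + s.im ^ 2 := by
          rw [Complex.sq_norm, Complex.normSq_apply]; simp; ring
        have e2 : ‖s - σ‖ ^ 2 = (s.re - σ) ^ 2 + s.im ^ 2 := by
          rw [Complex.sq_norm, Complex.normSq_apply]; simp; ring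
        have h2 : ‖s - z0‖ ^ 2 < R ^ 2 := by
          apply pow_lt_pow_left₀ hs (norm_nonneg _) (by norm_num)
        apply lt_of_pow_lt_pow_left₀ 2 hε.le
        rw [e1, hz0, hR] at h2
        rw [e2]
        push Not at h1
        nlinarith
      have : T =ᶠ[nhds s] H := by
        filter_upwards [Metric.isOpen_ball.mem_nhds hsb] with w hw using hTH w hw
      exact this.differentiableAt_iff.mpr
        ((hH s hsb).differentiableAt (Metric.isOpen_ball.mem_nhds hsb))
  have hmem : ((z0 - h : ℝ) : ℂ) ∈ Metric.ball (z0 : ℂ) R := by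
    simp only [Metric.mem_ball, Complex.dist_eq]
    rw [← Complex.ofReal_sub, Complex.norm_real, Real.norm_eq_abs]
    have : z0 - h - z0 = -h := by ring
    rw [this, abs_neg, abs_of_pos (by positivity)]
    rw [hh, hR]; linarith
  have hsum := Complex.hasSum_taylorSeries_on_ball hTd hmem
  -- the nonnegative terms
  let g : ℕ → Ω → ℝ := fun n ω => (h * (-X ω)) ^ n / n.factorial * Real.exp (z0 * X ω)
  have hgi : ∀ n, Integrable (g n) μ := by
    intro n
    have := (integrable_pow_mul_exp_of_mem_interior_integrableExpSet hz0m n).const_mul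
      ((-h) ^ n / n.factorial)
    refine this.congr (Eventually.of_forall fun ω => ?_)
    simp only [g]
    rw [show h * (-X ω) = (-h) * X ω by ring, mul_pow]; ring
  have hterm : ∀ n, ((n.factorial : ℂ))⁻¹ • (((z0 - h : ℝ) : ℂ) - z0) ^ n • iteratedDeriv n T z0
      = ((∫ ω, g n ω ∂μ : ℝ) : ℂ) := by
    intro n
    rw [(hT1 z0 (by simp [hz0, hε])).iteratedDeriv_eq, iteratedDeriv_complexMGF (by simpa using hz0m)]
    have e1 : ∀ ω, (X ω : ℂ) ^ n * Complex.exp (z0 * X ω) =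
        ((X ω ^ n * Real.exp (z0 * X ω) : ℝ) : ℂ) := by intro ω; push_cast; rfl
    simp_rw [e1]
    rw [integral_complex_ofReal]
    have e2 : (fun ω => g n ω) = fun ω => ((-h) ^ n / n.factorial) * (X ω ^ n * Real.exp (z0 * X ω)) := by
      funext ω
      simp only [g]
      rw [show h * (-X ω) = (-h) * X ω by ring, mul_pow]; ring
    rw [e2, integral_const_mul]
    generalize (∫ ω, X ω ^ n * Real.exp (z0 * X ω) ∂μ) = Q
    push_cast
    simp only [smul_eq_mul]
    ring
  simp_rw [hterm] at hsum
  have hsumm : Summable fun n => ∫ ω, g n ω ∂μ := by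
    have := hsum.summable
    exact_mod_cast this
  have hg0 : ∀ n, ∀ᵐ ω ∂μ, 0 ≤ g n ω := by
    intro n
    filter_upwards [hX] with ω hω
    have : 0 ≤ -X ω := by linarith
    have hh0 : 0 < h := by positivity
    simp only [g]
    positivity
  refine ⟨z0 - h, by rw [hz0, hh]; linarith, ?_⟩
  change Integrable (fun ω => Real.exp ((z0 - h) * X ω)) μ
  refine ⟨by fun_prop, ?_⟩
  rw [hasFiniteIntegral_iff_ofReal (Eventually.of_forall fun ω => (Real.exp_pos _).le)]
  have hpt : ∀ᵐ ω ∂μ, ENNReal.ofReal (Real.exp ((z0 - h) * X ω)) = ∑' n, ENNReal.ofReal (g n ω) := by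
    filter_upwards [ae_all_iff.mpr hg0] with ω hω
    have hs : HasSum (fun n => g n ω) (Real.exp (h * (-X ω)) * Real.exp (z0 * X ω)) := by
      apply HasSum.mul_right
      rw [Real.exp_eq_exp_ℝ]
      exact NormedSpace.expSeries_div_hasSum_exp (h * (-X ω))
    rw [← ENNReal.ofReal_tsum_of_nonneg hω hs.summable, hs.tsum_eq, ← Real.exp_add]
    congr 2; ring
  rw [lintegral_congr_ae hpt, lintegral_tsum (fun n => (hgi n).aemeasurable.ennreal_ofReal)]
  have : ∀ n, ∫⁻ ω, ENNReal.ofReal (g n ω) ∂μ = ENNReal.ofReal (∫ ω, g n ω ∂μ) := fun n =>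
    (ofReal_integral_eq_lintegral_ofReal (hgi n) (hg0 n)).symm
  simp_rw [this]
  rw [← ENNReal.ofReal_tsum_of_nonneg (fun n => integral_nonneg_of_ae (hg0 n)) hsumm]
  exact ENNReal.ofReal_lt_top

lemma integrableExpSet_up {Ω : Type*} {m : MeasurableSpace Ω} {μ : Measure Ω} {X : Ω → ℝ}
    (hXm : AEMeasurable X μ)
    (hX : ∀ᵐ ω ∂μ, X ω ≤ 0) {a b : ℝ} (ha : a ∈ integrableExpSet X μ) (hab : a ≤ b) :
    b ∈ integrableExpSet X μ := by
  change Integrable (fun ω => Real.exp (b * X ω)) μ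
  have ha' : Integrable (fun ω => Real.exp (a * X ω)) μ := ha
  refine ha'.mono' (by fun_prop) ?_
  filter_upwards [hX] with ω hω
  rw [Real.norm_eq_abs, abs_of_pos (Real.exp_pos _)]
  exact Real.exp_le_exp.mpr (mul_le_mul_of_nonpos_right hab hω)

lemma landau {Ω : Type*} {m : MeasurableSpace Ω} {μ : Measure Ω} {X : Ω → ℝ}
    (hXm : AEMeasurable X μ)
    (hX : ∀ᵐ ω ∂μ, X ω ≤ 0) {β s1 : ℝ} (hs1 : Set.Ioi s1 ⊆ integrableExpSet X μ) {V M : ℂ → ℂ}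
    (hV : Differentiable ℂ V) (hV0 : ∀ σ : ℝ, β < σ → V σ ≠ 0)
    (hM : ∀ σ : ℝ, β < σ → AnalyticAt ℂ M σ)
    (hder : ∀ s : ℂ, s1 < s.re → HasDerivAt (fun s => V s * complexMGF X μ s) (M s) s) :
    Set.Ioi β ⊆ integrableExpSet X μ := by
  intro σ0 hσ0
  by_contra hnot
  have hσ0 : β < σ0 := hσ0
  set I := integrableExpSet X μ with hI
  have hne : I.Nonempty := ⟨s1 + 1, hs1 (by simp)⟩
  have hlb : ∀ x ∈ I, σ0 ≤ x := by
    intro x hx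
    by_contra hlt
    push Not at hlt
    exact hnot (integrableExpSet_up hXm hX hx hlt.le)
  have hbdd : BddBelow I := ⟨σ0, hlb⟩
  set σ := sInf I with hσ
  have hσσ0 : σ0 ≤ σ := le_csInf hne hlb
  have hup : Set.Ioi σ ⊆ I := by
    intro x hx
    obtain ⟨y, hy, hyx⟩ := exists_lt_of_csInf_lt hne hx
    exact integrableExpSet_up hXm hX hy hyx.le
  have hIoiInt : Set.Ioi σ ⊆ interior I := interior_maximal hup isOpen_Ioi
  have hFan : ∀ s : ℂ, σ < s.re → AnalyticAt ℂ (complexMGF X μ) s := fun s hs =>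
    analyticAt_complexMGF (hIoiInt hs)
  have hopen : IsOpen {s : ℂ | σ < s.re} := isOpen_lt continuous_const Complex.continuous_re
  -- the segment
  set b : ℝ := max σ s1 + 1 with hb
  have hσb : σ < b := by rw [hb]; linarith [le_max_left σ s1]
  have hs1b : s1 < b := by rw [hb]; linarith [le_max_right σ s1]
  let K : Set ℂ := (fun x : ℝ => (x : ℂ)) '' Set.Icc σ b
  have hK : IsCompact K := isCompact_Icc.image Complex.continuous_ofReal
  have hKconv : Convex ℝ K := (convex_Icc σ b).linear_image Complex.ofRealCLM.toLinearMap
  let U : Set ℂ := {s | AnalyticAt ℂ M s} ∩ {s | V s ≠ 0}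
  have hU : IsOpen U := (isOpen_analyticAt ℂ M).inter
    (isOpen_ne_fun hV.continuous continuous_const)
  have hKU : K ⊆ U := by
    rintro _ ⟨x, hx, rfl⟩
    exact ⟨hM x (by linarith [hx.1]), hV0 x (by linarith [hx.1])⟩
  obtain ⟨ε, hε, hεU⟩ := hK.exists_thickening_subset_open hU hKU
  let N : Set ℂ := Metric.thickening ε K ∩ {s : ℂ | σ < s.re}
  have hNo : IsOpen N := Metric.isOpen_thickening.inter hopen
  have hhalf : Convex ℝ {s : ℂ | σ < s.re} := convex_halfSpace_re_gt σ
  have hNc : Convex ℝ N := (hKconv.thickening ε).inter hhalf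
  have hVF : ∀ s : ℂ, σ < s.re → AnalyticAt ℂ (fun s => V s * complexMGF X μ s) s := fun s hs =>
    (hV.analyticAt s).mul (hFan s hs)
  have hderN : ∀ s ∈ N, deriv (fun s => V s * complexMGF X μ s) s = M s := by
    have hA : AnalyticOnNhd ℂ (deriv (fun s => V s * complexMGF X μ s)) N := fun s hs =>
      (hVF s hs.2).deriv
    have hB : AnalyticOnNhd ℂ M N := fun s hs => (hεU hs.1).1
    have hbK : (b : ℂ) ∈ K := ⟨b, ⟨hσb.le, le_rfl⟩, rfl⟩
    have hbN : (b : ℂ) ∈ N := ⟨Metric.self_subset_thickening hε K hbK, by simpa using hσb⟩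
    refine hA.eqOn_of_preconnected_of_eventuallyEq hB hNc.isPreconnected hbN ?_
    have ho : IsOpen {s : ℂ | s1 < s.re} := isOpen_lt continuous_const Complex.continuous_re
    filter_upwards [ho.mem_nhds (show (b:ℂ) ∈ {s : ℂ | s1 < s.re} by simpa using hs1b)] with s hs
    exact (hder s hs).deriv
  have hσK : (σ : ℂ) ∈ K := ⟨σ, ⟨le_rfl, hσb.le⟩, rfl⟩
  have hball : Metric.ball (σ : ℂ) ε ⊆ Metric.thickening ε K :=
    Metric.ball_subset_thickening hσK ε
  have hMd : DifferentiableOn ℂ M (Metric.ball (σ : ℂ) ε) := fun s hs =>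
    (hεU (hball hs)).1.differentiableAt.differentiableWithinAt
  obtain ⟨P, hP⟩ := hMd.isExactOn_ball
  let W : Set ℂ := Metric.ball (σ : ℂ) ε ∩ {s : ℂ | σ < s.re}
  have hWo : IsOpen W := Metric.isOpen_ball.inter hopen
  have hWc : Convex ℝ W := (convex_ball _ _).inter hhalf
  have hconst : ∃ C : ℂ, ∀ s ∈ W, V s * complexMGF X μ s = P s + C := by
    have hd : ∀ s ∈ W, HasDerivAt (fun s => V s * complexMGF X μ s - P s) 0 s := by
      intro s hs
      have h1 := (hVF s hs.2).differentiableAt.hasDerivAt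
      rw [hderN s ⟨hball hs.1, hs.2⟩] at h1
      have h2 := h1.sub (hP s hs.1)
      rw [sub_self] at h2
      exact h2
    obtain ⟨C, hC⟩ := hWo.exists_is_const_of_deriv_eq_zero hWc.isPreconnected
      (fun s hs => (hd s hs).differentiableAt.differentiableWithinAt) (fun s hs => (hd s hs).deriv)
    exact ⟨C, fun s hs => by rw [← hC s hs]; ring⟩
  obtain ⟨C, hC⟩ := hconst
  have hH : DifferentiableOn ℂ (fun s => (P s + C) / V s) (Metric.ball (σ : ℂ) ε) := by
    intro s hs
    have := (hεU (hball hs)).2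
    exact (((hP s hs).differentiableAt.add_const C).div (hV s) this).differentiableWithinAt
  obtain ⟨τ, hτ, hτI⟩ := landau_core hX hε hup hH (by
    intro s hs hsr
    have h1 : V s ≠ 0 := (hεU (hball hs)).2
    rw [eq_div_iff h1, ← hC s ⟨hs, hsr⟩]; ring)
  exact absurd (csInf_le hbdd hτI) (not_le.mpr hτ)

end Landau

section Dens
open ProbabilityTheory

noncomputable def nlog (t : ℝ) : ℝ := -Real.log t

lemma measurable_nlog : Measurable nlog := Real.measurable_log.neg

noncomputable def dm (a : ℝ) (w : ℝ → ℝ) : Measure ℝ :=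
  (volume.restrict (Set.Ioi a)).withDensity (fun t => ((w t).toNNReal : ENNReal))

lemma exp_nlog (s : ℂ) {t : ℝ} (ht : 0 < t) : Complex.exp (s * (nlog t : ℝ)) = (t : ℂ) ^ (-s) := by
  rw [Complex.cpow_def_of_ne_zero (by exact_mod_cast ht.ne'), nlog, ← Complex.ofReal_log ht.le]
  congr 1
  push_cast; ring

lemma exp_nlog_real (s : ℝ) {t : ℝ} (ht : 0 < t) : Real.exp (s * nlog t) = t ^ (-s) := by
  rw [Real.rpow_def_of_pos ht, nlog]
  congr 1
  ring

lemma dm_nonpos {a : ℝ} (ha : 1 ≤ a) (w : ℝ → ℝ) : ∀ᵐ t ∂(dm a w), nlog t ≤ 0 := by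
  apply (withDensity_absolutelyContinuous _ _).ae_le
  filter_upwards [ae_restrict_mem measurableSet_Ioi] with t ht
  have : a < t := ht
  rw [nlog]
  linarith [Real.log_nonneg (ha.trans this.le)]

lemma dm_mgf {a : ℝ} (ha : 0 < a) {w : ℝ → ℝ} (hw : AEMeasurable w (volume.restrict (Set.Ioi a)))
    (h0 : ∀ t, a < t → 0 ≤ w t) (s : ℂ) :
    complexMGF nlog (dm a w) s = ∫ t in Set.Ioi a, (w t : ℂ) * (t : ℂ) ^ (-s) := by
  rw [complexMGF, dm, integral_withDensity_eq_integral_smul₀ hw.real_toNNReal]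
  apply setIntegral_congr_fun measurableSet_Ioi
  intro t ht
  have ht : a < t := ht
  simp only
  rw [exp_nlog s (ha.trans ht), NNReal.smul_def, Real.coe_toNNReal _ (h0 t ht)]
  simp

lemma dm_mem {a : ℝ} (ha : 0 < a) {w : ℝ → ℝ} (hw : AEMeasurable w (volume.restrict (Set.Ioi a)))
    (h0 : ∀ t, a < t → 0 ≤ w t) (σ : ℝ) :
    σ ∈ integrableExpSet nlog (dm a w) ↔ IntegrableOn (fun t => w t * t ^ (-σ)) (Set.Ioi a) := by
  change Integrable _ _ ↔ _
  rw [dm, integrable_withDensity_iff_integrable_smul₀ hw.real_toNNReal]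
  apply integrableOn_congr_fun _ measurableSet_Ioi
  intro t ht
  have ht : a < t := ht
  simp only
  rw [exp_nlog_real σ (ha.trans ht), NNReal.smul_def, Real.coe_toNNReal _ (h0 t ht)]
  simp

lemma dm_hasDerivAt {a : ℝ} (ha : 0 < a) {w : ℝ → ℝ} (hw : AEMeasurable w (volume.restrict (Set.Ioi a)))
    (h0 : ∀ t, a < t → 0 ≤ w t) {σ0 : ℝ}
    (hi : ∀ σ, σ0 < σ → IntegrableOn (fun t => w t * t ^ (-σ)) (Set.Ioi a)) {s : ℂ} (hs : σ0 < s.re) :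
    HasDerivAt (fun s : ℂ => ∫ t in Set.Ioi a, (w t : ℂ) * (t : ℂ) ^ (-s))
      (∫ t in Set.Ioi a, -((w t * Real.log t : ℝ) : ℂ) * (t : ℂ) ^ (-s)) s := by
  have hsub : Set.Ioi σ0 ⊆ interior (integrableExpSet nlog (dm a w)) :=
    interior_maximal (fun σ hσ => (dm_mem ha hw h0 σ).mpr (hi σ hσ)) isOpen_Ioi
  have h := hasDerivAt_complexMGF (hsub hs)
  have e : (fun s : ℂ => ∫ t in Set.Ioi a, (w t : ℂ) * (t : ℂ) ^ (-s)) =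
      complexMGF nlog (dm a w) := by
    funext s; rw [dm_mgf ha hw h0]
  rw [e]
  convert h using 1
  rw [dm, integral_withDensity_eq_integral_smul₀ hw.real_toNNReal]
  apply setIntegral_congr_fun measurableSet_Ioi
  intro t ht
  have ht : a < t := ht
  simp only
  rw [exp_nlog s (ha.trans ht), NNReal.smul_def, Real.coe_toNNReal _ (h0 t ht), nlog]
  simp only [Complex.real_smul]
  push_cast
  ring

/-- Fubini for the primitive. -/
lemma fubini_aux {a : ℝ} (ha : 0 < a) {g : ℝ → ℝ} {z : ℂ} (hz : 0 < z.re)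
    (hg : IntegrableOn (fun t => g t * t ^ (-z.re)) (Set.Ioi a)) :
    IntegrableOn (fun x : ℝ => ((∫ t in a..x, g t : ℝ) : ℂ) * (x : ℂ) ^ (-(z + 1))) (Set.Ioi a) ∧
    ∫ x in Set.Ioi a, ((∫ t in a..x, g t : ℝ) : ℂ) * (x : ℂ) ^ (-(z + 1)) =
      (1 / z) * ∫ t in Set.Ioi a, (g t : ℂ) * (t : ℂ) ^ (-z) := by
  set ν : Measure ℝ := volume.restrict (Set.Ioi a) with hν
  have hz0 : z ≠ 0 := by rintro rfl; simp at hz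
  have hmem : ∀ᵐ t ∂ν, a < t := ae_restrict_mem measurableSet_Ioi
  have hgm : AEStronglyMeasurable g ν := by
    have h1 : AEStronglyMeasurable (fun t : ℝ => (g t * t ^ (-z.re)) * t ^ z.re) ν :=
      hg.aestronglyMeasurable.mul (by fun_prop)
    refine h1.congr ?_
    filter_upwards [hmem] with t ht
    rw [mul_assoc, ← Real.rpow_add (ha.trans ht)]; simp
  let S : Set (ℝ × ℝ) := {p | p.1 < p.2}
  have hS : MeasurableSet S := measurableSet_lt measurable_fst measurable_snd
  let f : ℝ → ℝ → ℂ := fun t x => S.indicator (fun p => (g p.1 : ℂ) * (p.2 : ℂ) ^ (-(z + 1))) (t, x)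
  have hf1 : ∀ t x, f t x = (Set.Ioi t).indicator (fun x => (g t : ℂ) * (x : ℂ) ^ (-(z + 1))) x := by
    intro t x
    simp only [f, S, Set.indicator, Set.mem_setOf_eq, Set.mem_Ioi]
  have hf2 : ∀ t x, f t x = (Set.Iio x).indicator (fun t => (g t : ℂ) * (x : ℂ) ^ (-(z + 1))) t := by
    intro t x
    simp only [f, S, Set.indicator, Set.mem_setOf_eq, Set.mem_Iio]
  have hfm : AEStronglyMeasurable (Function.uncurry f) (ν.prod ν) := by
    have : AEStronglyMeasurable (fun p : ℝ × ℝ => (g p.1 : ℂ) * (p.2 : ℂ) ^ (-(z + 1))) (ν.prod ν) := by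
      apply AEStronglyMeasurable.mul
      · exact Complex.continuous_ofReal.comp_aestronglyMeasurable hgm.comp_fst
      · exact (Measurable.pow_const (by fun_prop) _).aestronglyMeasurable
    exact this.indicator hS
  have hinter : ∀ t, a < t → Set.Ioi a ∩ Set.Ioi t = Set.Ioi t := by
    intro t ht; ext x; simp only [Set.mem_inter_iff, Set.mem_Ioi]
    exact ⟨fun h => h.2, fun h => ⟨ht.trans h, h⟩⟩
  have hre : (-(z + 1)).re < -1 := by simp; linarith
  have hfi : Integrable (Function.uncurry f) (ν.prod ν) := by
    rw [integrable_prod_iff hfm]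
    constructor
    · filter_upwards [hmem] with t ht
      simp only [Function.uncurry_apply_pair]
      simp_rw [hf1]
      rw [integrable_indicator_iff measurableSet_Ioi, IntegrableOn, hν,
        Measure.restrict_restrict measurableSet_Ioi, Set.inter_comm, hinter t ht]
      exact ((integrableOn_Ioi_cpow_of_lt hre (ha.trans ht)).const_mul _)
    · have h1 : Integrable (fun t => |g t * t ^ (-z.re)| * (1 / z.re)) ν := hg.abs.mul_const _
      refine h1.congr ?_
      filter_upwards [hmem] with t ht
      simp only [Function.uncurry_apply_pair]
      simp_rw [hf1, norm_indicator_eq_indicator_norm]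
      rw [integral_indicator measurableSet_Ioi, hν, Measure.restrict_restrict measurableSet_Ioi,
        Set.inter_comm, hinter t ht]
      have h2 : ∫ x in Set.Ioi t, ‖(g t : ℂ) * (x : ℂ) ^ (-(z + 1))‖ =
          ∫ x in Set.Ioi t, |g t| * x ^ (-(z.re + 1)) := by
        apply setIntegral_congr_fun measurableSet_Ioi
        intro x hx
        have hx : t < x := hx
        simp only
        rw [norm_mul, Complex.norm_cpow_eq_rpow_re_of_pos (by linarith)]
        simp
      rw [h2, integral_const_mul, integral_Ioi_rpow_of_lt (by linarith) (ha.trans ht), abs_mul,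
        abs_of_pos (Real.rpow_pos_of_pos (ha.trans ht) _)]
      have : -(z.re + 1) + 1 = - z.re := by ring
      rw [this]
      field_simp
  have hin1 : ∀ x, a < x → ∫ t, f t x ∂ν = ((∫ t in a..x, g t : ℝ) : ℂ) * (x : ℂ) ^ (-(z + 1)) := by
    intro x hx
    simp_rw [hf2]
    rw [integral_indicator measurableSet_Iio, hν, Measure.restrict_restrict measurableSet_Iio,
      integral_mul_const, integral_complex_ofReal, intervalIntegral.integral_of_le hx.le,
      integral_Ioc_eq_integral_Ioo]
    have : Set.Iio x ∩ Set.Ioi a = Set.Ioo a x := by ext; simp [and_comm]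
    rw [this]
  have hin2 : ∀ t, a < t → ∫ x, f t x ∂ν = (1 / z) * ((g t : ℂ) * (t : ℂ) ^ (-z)) := by
    intro t ht
    simp_rw [hf1]
    rw [integral_indicator measurableSet_Ioi, hν, Measure.restrict_restrict measurableSet_Ioi,
      Set.inter_comm, hinter t ht, integral_const_mul,
      integral_Ioi_cpow_of_lt hre (ha.trans ht)]
    have : -(z + 1) + 1 = -z := by ring
    rw [this]
    field_simp
  constructor
  · have h1 := hfi.integral_prod_right
    refine h1.congr ?_
    filter_upwards [hmem] with x hx
    exact hin1 x hx
  · rw [← integral_const_mul]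
    rw [setIntegral_congr_fun measurableSet_Ioi (fun x hx => (hin1 x hx).symm),
      setIntegral_congr_fun measurableSet_Ioi (fun x hx => (hin2 x hx).symm)]
    exact (integral_integral_swap hfi).symm

lemma fubini_prim {a : ℝ} (ha : 0 < a) {g : ℝ → ℝ} {z : ℂ} (hz : 0 < z.re)
    (hg : IntegrableOn (fun t => g t * t ^ (-z.re)) (Set.Ioi a)) :
    IntegrableOn (fun x => (∫ t in a..x, g t) * x ^ (-(z.re + 1))) (Set.Ioi a) ∧
    ∫ x in Set.Ioi a, ((∫ t in a..x, g t : ℝ) : ℂ) * (x : ℂ) ^ (-(z + 1)) =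
      (1 / z) * ∫ t in Set.Ioi a, (g t : ℂ) * (t : ℂ) ^ (-z) := by
  refine ⟨?_, (fubini_aux ha hz hg).2⟩
  have h := (fubini_aux (z := (z.re : ℂ)) ha (by simpa using hz) (by simpa using hg)).1
  refine h.re.congr ?_
  filter_upwards [ae_restrict_mem measurableSet_Ioi] with x hx
  have hx : a < x := hx
  have : (x : ℂ) ^ (-((z.re : ℂ) + 1)) = ((x ^ (-(z.re + 1)) : ℝ) : ℂ) := by
    rw [Complex.ofReal_cpow (ha.trans hx).le]; push_cast; rfl
  rw [this, ← Complex.ofReal_mul]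
  simp

end Dens

section LiPi

noncomputable def gli (u : ℝ) : ℝ := if 0 < u then 1 / Real.log u - 1 / (u - 1) else 0

lemma gli_bound (u : ℝ) : ‖gli u‖ ≤ 1 := by
  rw [gli]
  split_ifs with hu
  swap
  · simp
  rcases lt_trichotomy u 1 with h | h | h
  · have h1 : Real.log u < 0 := Real.log_neg hu h
    have h2 : Real.log u ≤ u - 1 := Real.log_le_sub_one_of_pos hu
    have h3 : 1 - u⁻¹ ≤ Real.log u := Real.one_sub_inv_le_log_of_pos hu
    have h4 : (u - 1) / u ≤ Real.log u := by
      have : (u - 1) / u = 1 - u⁻¹ := by field_simp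
      rw [this]; exact h3
    have h5 : u - 1 < 0 := by linarith
    have a1 : 1 / (u - 1) ≤ 1 / Real.log u := one_div_le_one_div_of_neg_of_le h5 h2 |>.trans' le_rfl
    have a2 : 1 / Real.log u ≤ 1 / ((u - 1) / u) := one_div_le_one_div_of_neg_of_le h1 h4
    have a3 : 1 / ((u - 1) / u) = 1 + 1 / (u - 1) := by
      have := h5.ne
      field_simp; ring
    rw [Real.norm_eq_abs, abs_le]; constructor <;> linarith
  · subst h; simp
  · have h1 : 0 < Real.log u := Real.log_pos h
    have h2 : Real.log u ≤ u - 1 := Real.log_le_sub_one_of_pos hu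
    have h3 : 1 - u⁻¹ ≤ Real.log u := Real.one_sub_inv_le_log_of_pos hu
    have h4 : (u - 1) / u ≤ Real.log u := by
      have : (u - 1) / u = 1 - u⁻¹ := by field_simp
      rw [this]; exact h3
    have h5 : 0 < u - 1 := by linarith
    have a1 : 1 / (u - 1) ≤ 1 / Real.log u := one_div_le_one_div_of_le h1 h2
    have a2 : 1 / Real.log u ≤ 1 / ((u - 1) / u) := one_div_le_one_div_of_le (by positivity) h4
    have a3 : 1 / ((u - 1) / u) = 1 + 1 / (u - 1) := by
      have := h5.ne'
      field_simp; ring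
    rw [Real.norm_eq_abs, abs_le]; constructor <;> linarith

lemma gli_meas : Measurable gli := by
  unfold gli
  refine Measurable.ite measurableSet_Ioi ?_ measurable_const
  fun_prop

lemma gli_int (a b : ℝ) : IntervalIntegrable gli volume a b := by
  rw [intervalIntegrable_iff]
  refine Integrable.mono' (g := fun _ => (1:ℝ)) (intervalIntegrable_iff.mp intervalIntegrable_const) gli_meas.aestronglyMeasurable
    (Eventually.of_forall gli_bound)

lemma inv_log_int {a b : ℝ} (ha : 1 < a) (hab : a ≤ b) :
    IntervalIntegrable (fun u => 1 / Real.log u) volume a b := by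
  apply ContinuousOn.intervalIntegrable
  rw [Set.uIcc_of_le hab]
  apply ContinuousOn.div continuousOn_const
  · apply Real.continuousOn_log.mono
    intro x hx
    simp only [Set.mem_compl_iff, Set.mem_singleton_iff]
    linarith [hx.1]
  · intro x hx
    exact (Real.log_pos (lt_of_lt_of_le ha hx.1)).ne'

lemma li_tendsto {x : ℝ} (hx : 2 ≤ x) :
    Tendsto (fun ε => (∫ u in (0:ℝ)..(1 - ε), 1 / Real.log u) + ∫ u in (1 + ε)..x, 1 / Real.log u)
      (nhdsWithin (0:ℝ) (Set.Ioi 0))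
      (nhds ((∫ u in (0:ℝ)..1, gli u) + (∫ u in (1:ℝ)..2, gli u) + ∫ u in (2:ℝ)..x, 1 / Real.log u)) := by
  have hcont : Continuous fun b => ∫ u in (0:ℝ)..b, gli u :=
    intervalIntegral.continuous_primitive (fun a b => gli_int a b) 0
  have key : ∀ᶠ ε in nhdsWithin (0:ℝ) (Set.Ioi 0),
      (∫ u in (0:ℝ)..(1 - ε), gli u) + ((∫ u in (0:ℝ)..2, gli u) - ∫ u in (0:ℝ)..(1 + ε), gli u)
        + (∫ u in (2:ℝ)..x, 1 / Real.log u) =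
      (∫ u in (0:ℝ)..(1 - ε), 1 / Real.log u) + ∫ u in (1 + ε)..x, 1 / Real.log u := by
    filter_upwards [Ioo_mem_nhdsGT (show (0:ℝ) < 1/2 by norm_num)] with ε hε
    have e0 : 0 < ε := hε.1
    have e1 : ε < 1/2 := hε.2
    have i1 : IntervalIntegrable (fun u : ℝ => 1 / (u - 1)) volume 0 (1 - ε) := by
      apply ContinuousOn.intervalIntegrable
      rw [Set.uIcc_of_le (by linarith)]
      apply ContinuousOn.div continuousOn_const (by fun_prop)
      intro u hu; have := hu.2; exact (by linarith : u - 1 < 0).ne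
    have i2 : IntervalIntegrable (fun u : ℝ => 1 / (u - 1)) volume (1 + ε) 2 := by
      apply ContinuousOn.intervalIntegrable
      rw [Set.uIcc_of_le (by linarith)]
      apply ContinuousOn.div continuousOn_const (by fun_prop)
      intro u hu; have := hu.1; exact (by linarith : 0 < u - 1).ne'
    have j1 : ∫ u in (0:ℝ)..(1 - ε), 1 / Real.log u =
        (∫ u in (0:ℝ)..(1 - ε), gli u) + ∫ u in (0:ℝ)..(1 - ε), 1 / (u - 1) := by
      rw [← intervalIntegral.integral_add (gli_int _ _) i1]
      apply intervalIntegral.integral_congr_ae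
      refine Eventually.of_forall fun u hu => ?_
      rw [Set.uIoc_of_le (by linarith)] at hu
      simp only [gli, if_pos hu.1]; ring
    have j2 : ∫ u in (1 + ε)..2, 1 / Real.log u =
        (∫ u in (1 + ε)..2, gli u) + ∫ u in (1 + ε)..2, 1 / (u - 1) := by
      rw [← intervalIntegral.integral_add (gli_int _ _) i2]
      apply intervalIntegral.integral_congr_ae
      refine Eventually.of_forall fun u hu => ?_
      rw [Set.uIoc_of_le (by linarith)] at hu
      have : 0 < u := by linarith [hu.1]
      simp only [gli, if_pos this]; ring
    have k1 : ∫ u in (0:ℝ)..(1 - ε), 1 / (u - 1) = Real.log ε := by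
      rw [intervalIntegral.integral_comp_sub_right (fun v => 1 / v) 1]
      rw [integral_one_div_of_neg (by norm_num) (by linarith)]
      congr 1; ring_nf
    have k2 : ∫ u in (1 + ε)..2, 1 / (u - 1) = - Real.log ε := by
      rw [intervalIntegral.integral_comp_sub_right (fun v => 1 / v) 1]
      rw [integral_one_div_of_pos (by linarith) (by norm_num), ← Real.log_inv]
      congr 1; norm_num
    rw [← intervalIntegral.integral_add_adjacent_intervals (inv_log_int (by linarith) (by linarith : 1 + ε ≤ 2))
      (inv_log_int (by norm_num) hx), j1, j2, k1, k2,
      ← intervalIntegral.integral_interval_sub_left (gli_int 0 2) (gli_int 0 (1 + ε))]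
    ring
  refine Tendsto.congr' key ?_
  have h1 : Tendsto (fun ε : ℝ => (∫ u in (0:ℝ)..(1 - ε), gli u) +
      ((∫ u in (0:ℝ)..2, gli u) - ∫ u in (0:ℝ)..(1 + ε), gli u) + (∫ u in (2:ℝ)..x, 1 / Real.log u))
      (nhds 0) (nhds ((∫ u in (0:ℝ)..(1 - 0), gli u) +
      ((∫ u in (0:ℝ)..2, gli u) - ∫ u in (0:ℝ)..(1 + 0), gli u) + (∫ u in (2:ℝ)..x, 1 / Real.log u))) := by
    apply Continuous.tendsto
    have c1 : Continuous fun ε : ℝ => ∫ u in (0:ℝ)..(1 - ε), gli u :=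
      hcont.comp (continuous_const.sub continuous_id)
    have c2 : Continuous fun ε : ℝ => ∫ u in (0:ℝ)..(1 + ε), gli u :=
      hcont.comp (continuous_const.add continuous_id)
    exact (c1.add (continuous_const.sub c2)).add continuous_const
  rw [sub_zero, add_zero, intervalIntegral.integral_interval_sub_left (gli_int 0 2) (gli_int 0 1)] at h1
  exact h1.mono_left nhdsWithin_le_nhds

lemma li_eq {x : ℝ} (hx : 2 ≤ x) : li x = li 2 + ∫ u in (2:ℝ)..x, 1 / Real.log u := by
  have h1 : li x = _ := (li_tendsto hx).limUnder_eq
  have h2 : li 2 = _ := (li_tendsto (le_refl 2)).limUnder_eq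
  rw [h1, h2]; simp

noncomputable def bR (n : ℕ) : ℝ := if IsPrimePow n then (1 : ℝ) / (n.factorization n.minFac) else 0

lemma bR_nonneg (n : ℕ) : 0 ≤ bR n := by
  unfold bR; split_ifs <;> positivity

lemma bR_le_one (n : ℕ) : bR n ≤ 1 := by
  unfold bR
  split_ifs
  · rw [one_div]; exact Nat.cast_inv_le_one _
  · norm_num

lemma bR_log (n : ℕ) : bR n * Real.log n = ArithmeticFunction.vonMangoldt n := by
  rw [ArithmeticFunction.vonMangoldt_apply, bR]
  split_ifs with h
  · have h1 := h.minFac_pow_factorization_eq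
    have h2 : (n.factorization n.minFac) ≠ 0 := by
      intro h0; rw [h0, pow_zero] at h1; rw [← h1] at h; exact not_isPrimePow_one h
    have h3 : Real.log n = n.factorization n.minFac * Real.log n.minFac := by
      conv_lhs => rw [← h1]
      push_cast
      rw [Real.log_pow]
    rw [h3]
    have : (n.factorization n.minFac : ℝ) ≠ 0 := by exact_mod_cast h2
    field_simp
  · simp

lemma PiR_eq (t : ℝ) : PiR t = ∑ n ∈ Finset.Icc 1 ⌊t⌋₊, bR n := rfl

lemma PiR_nonneg (t : ℝ) : 0 ≤ PiR t := Finset.sum_nonneg fun n _ => bR_nonneg n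

lemma PiR_le {t : ℝ} (ht : 0 ≤ t) : PiR t ≤ t := by
  rw [PiR_eq]
  calc _ ≤ ∑ n ∈ Finset.Icc 1 ⌊t⌋₊, (1:ℝ) := Finset.sum_le_sum fun n _ => bR_le_one n
    _ = ⌊t⌋₊ := by simp
    _ ≤ t := Nat.floor_le ht

lemma PiR_zero {t : ℝ} (ht : t < 2) : PiR t = 0 := by
  rw [PiR_eq]
  apply Finset.sum_eq_zero
  intro n hn
  have h1 := Finset.mem_Icc.mp hn
  have h2 : ⌊t⌋₊ < 2 := by
    by_contra h; push Not at h
    have := Nat.le_of_ceil_le (n := 2) (a := (2:ℝ)) (by simp)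
    have h3 := (Nat.le_floor_iff' (by norm_num)).mp h
    push_cast at h3; linarith
  have : n = 1 := by omega
  subst this
  simp [bR, not_isPrimePow_one]

lemma PiR_mono : Monotone PiR := by
  intro x y hxy
  rw [PiR_eq, PiR_eq]
  apply Finset.sum_le_sum_of_subset_of_nonneg
  · exact Finset.Icc_subset_Icc le_rfl (Nat.floor_le_floor hxy)
  · intro n _ _; exact bR_nonneg n

lemma bR_abs : LSeries.abscissaOfAbsConv (fun n => (bR n : ℂ)) ≤ 1 := by
  apply LSeries.abscissaOfAbsConv_le_of_le_const
  refine ⟨1, fun n _ => ?_⟩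
  rw [Complex.norm_real, Real.norm_eq_abs, abs_of_nonneg (bR_nonneg n)]
  exact bR_le_one n

lemma G_deriv {s : ℂ} (hs : 1 < s.re) :
    HasDerivAt (LSeries fun n => (bR n : ℂ)) (deriv riemannZeta s / riemannZeta s) s := by
  have h1 : LSeries.abscissaOfAbsConv (fun n => (bR n : ℂ)) < s.re :=
    lt_of_le_of_lt bR_abs (by exact_mod_cast hs)
  have h := LSeries_hasDerivAt h1
  convert h using 1
  have h2 := ArithmeticFunction.LSeries_vonMangoldt_eq_deriv_riemannZeta_div hs
  have h3 : LSeries.logMul (fun n => (bR n : ℂ)) = fun n => ((ArithmeticFunction.vonMangoldt n : ℝ) : ℂ) := by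
    funext n
    rw [LSeries.logMul, ← bR_log]
    push_cast
    rw [mul_comm]
  rw [h3, h2]
  ring

lemma G_int {s : ℂ} (hs : 1 < s.re) :
    LSeries (fun n => (bR n : ℂ)) s = s * ∫ t in Set.Ioi (2:ℝ), (PiR t : ℂ) * (t : ℂ) ^ (-(s + 1)) := by
  have h := LSeries_eq_mul_integral_of_nonneg bR (r := 1) zero_le_one hs (by
    apply Asymptotics.IsBigO.of_bound 1
    refine Eventually.of_forall fun n => ?_
    rw [Real.rpow_one, one_mul, Real.norm_eq_abs, Real.norm_eq_abs, abs_of_nonneg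
      (Finset.sum_nonneg fun n _ => bR_nonneg n), abs_of_nonneg (by positivity)]
    calc _ ≤ ∑ n ∈ Finset.Icc 1 n, (1:ℝ) := Finset.sum_le_sum fun n _ => bR_le_one n
      _ = n := by simp) bR_nonneg
  rw [h]
  congr 1
  have h2 : ∀ t : ℝ, (∑ k ∈ Finset.Icc 1 ⌊t⌋₊, (bR k : ℂ)) = (PiR t : ℂ) := by
    intro t; rw [PiR_eq]; push_cast; rfl
  simp_rw [h2]
  rw [← integral_indicator measurableSet_Ioi, ← integral_indicator measurableSet_Ioi]
  apply integral_congr_ae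
  filter_upwards [Measure.ae_ne volume (2:ℝ)] with t ht
  simp only [Set.indicator, Set.mem_Ioi]
  rcases lt_or_gt_of_ne ht with h | h
  · rw [PiR_zero h]; simp
  · rw [if_pos h, if_pos (by linarith)]

end LiPi

section ZetaReal

noncomputable def Zf : ℂ → ℂ := Function.update (fun s => (s - 1) * riemannZeta s) 1 1

lemma Zf_one : Zf 1 = 1 := by simp [Zf]

lemma Zf_ne {s : ℂ} (hs : s ≠ 1) : Zf s = (s - 1) * riemannZeta s := by simp [Zf, hs]

lemma Zf_diff : Differentiable ℂ Zf := by
  have h1 : DifferentiableOn ℂ Zf (Set.univ \ {1}) := by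
    intro s hs
    have hs1 : s ≠ 1 := hs.2
    have : Zf =ᶠ[nhds s] fun s => (s - 1) * riemannZeta s := by
      filter_upwards [isOpen_ne.mem_nhds hs1] with w hw using Zf_ne hw
    apply DifferentiableAt.differentiableWithinAt
    rw [this.differentiableAt_iff]
    exact (differentiableAt_id.sub_const 1).mul (differentiableAt_riemannZeta hs1)
  have h2 : ContinuousAt Zf 1 := by
    rw [Zf, continuousAt_update_same]
    exact riemannZeta_residue_one
  have := (Complex.differentiableOn_compl_singleton_and_continuousAt_iff
    (s := Set.univ) (c := 1) univ_mem).mp ⟨h1, h2⟩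
  exact differentiableOn_univ.mp this

noncomputable def wfr (t : ℝ) : ℝ := Int.fract t / t

lemma wfr_meas : Measurable wfr := by unfold wfr; exact measurable_fract.div measurable_id

lemma wfr_nonneg (t : ℝ) (ht : 1 < t) : 0 ≤ wfr t := by
  unfold wfr; exact div_nonneg (Int.fract_nonneg t) (by linarith)

lemma wfr_int (σ : ℝ) (hσ : 0 < σ) : IntegrableOn (fun t => wfr t * t ^ (-σ)) (Set.Ioi 1) := by
  have h := integrableOn_Ioi_rpow_of_lt (show -(σ + 1) < -1 by linarith) one_pos
  refine Integrable.mono' h ?_ ?_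
  · exact (wfr_meas.mul (by fun_prop)).aestronglyMeasurable
  · filter_upwards [ae_restrict_mem measurableSet_Ioi] with t ht
    have ht : 1 < t := ht
    have ht0 : 0 < t := by linarith
    rw [norm_mul, Real.norm_eq_abs, Real.norm_eq_abs, abs_of_nonneg (wfr_nonneg t ht),
      abs_of_pos (Real.rpow_pos_of_pos ht0 _)]
    have : t ^ (-(σ + 1)) = 1 / t * t ^ (-σ) := by
      rw [show -(σ + 1) = -1 + -σ by ring, Real.rpow_add ht0, Real.rpow_neg_one, one_div]
    rw [this]
    apply mul_le_mul_of_nonneg_right _ (Real.rpow_nonneg ht0.le _)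
    unfold wfr
    exact div_le_div_of_nonneg_right (Int.fract_lt_one t).le ht0.le

noncomputable def Phi (s : ℂ) : ℂ := ∫ t in Set.Ioi (1:ℝ), (wfr t : ℂ) * (t : ℂ) ^ (-s)

lemma Phi_diff {s : ℂ} (hs : 0 < s.re) : DifferentiableAt ℂ Phi s :=
  (dm_hasDerivAt one_pos wfr_meas.aemeasurable wfr_nonneg wfr_int hs).differentiableAt

lemma zeta_Phi {s : ℂ} (hs : 1 < s.re) : riemannZeta s = s / (s - 1) - s * Phi s := by
  have hs1 : s - 1 ≠ 0 := by
    intro h; have := congrArg Complex.re h; simp at this; linarith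
  have h := LSeries_eq_mul_integral_of_nonneg (fun _ => (1:ℝ)) (r := 1) zero_le_one hs (by
    apply Asymptotics.IsBigO.of_bound 1
    refine Eventually.of_forall fun n => ?_
    simp) (fun _ => zero_le_one)
  have h1 : LSeries (fun _ => ((1:ℝ):ℂ)) s = riemannZeta s := by
    have := LSeries_one_eq_riemannZeta hs
    rw [← this]
    simp only [Complex.ofReal_one]
    rfl
  rw [← h1, h]
  have h2 : ∀ t ∈ Set.Ioi (1:ℝ), (∑ k ∈ Finset.Icc 1 ⌊t⌋₊, ((1:ℝ):ℂ)) * (t:ℂ) ^ (-(s + 1)) =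
      (t:ℂ) ^ (-s) - (wfr t : ℂ) * (t : ℂ) ^ (-s) := by
    intro t ht
    have ht : 1 < t := ht
    have ht0 : (t:ℂ) ≠ 0 := by exact_mod_cast (by linarith : t ≠ 0)
    have e1 : (∑ k ∈ Finset.Icc 1 ⌊t⌋₊, ((1:ℝ):ℂ)) = ((t - Int.fract t : ℝ) : ℂ) := by
      have : t - Int.fract t = (⌊t⌋₊ : ℝ) := by
        rw [natCast_floor_eq_intCast_floor (by linarith : 0 ≤ t)]
        have := Int.floor_add_fract t
        linarith
      rw [this]; simp
    rw [e1, wfr, show -(s + 1) = -s + (-1) by ring, Complex.cpow_add _ _ ht0, Complex.cpow_neg_one]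
    push_cast
    field_simp
  rw [setIntegral_congr_fun measurableSet_Ioi h2, integral_sub, integral_Ioi_cpow_of_lt
    (by simpa using hs) one_pos, ← Phi]
  · simp only [Complex.ofReal_one, Complex.one_cpow]
    have : -s + 1 ≠ 0 := by intro h; apply hs1; linear_combination -h
    field_simp
    ring
  · exact integrableOn_Ioi_cpow_of_lt (by simpa using hs) one_pos
  · refine Integrable.mono' (wfr_int s.re (by linarith)) ?_ ?_
    · exact (Measurable.mul (by have := wfr_meas; fun_prop)
        (Measurable.pow_const (by fun_prop) _)).aestronglyMeasurable
    · filter_upwards [ae_restrict_mem measurableSet_Ioi] with t ht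
      have ht : 1 < t := ht
      rw [norm_mul, Complex.norm_real, Complex.norm_cpow_eq_rpow_re_of_pos (by linarith),
        Real.norm_eq_abs, abs_of_nonneg (wfr_nonneg t ht)]
      simp

lemma Zf_eq {s : ℂ} (hs : 0 < s.re) : Zf s = s - s * (s - 1) * Phi s := by
  have ho : IsOpen {s : ℂ | 0 < s.re} := isOpen_lt continuous_const Complex.continuous_re
  have hA : AnalyticOnNhd ℂ Zf {s : ℂ | 0 < s.re} := fun s _ => Zf_diff.analyticAt s
  have hB : AnalyticOnNhd ℂ (fun s => s - s * (s - 1) * Phi s) {s : ℂ | 0 < s.re} := by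
    apply DifferentiableOn.analyticOnNhd _ ho
    intro s hs
    have := Phi_diff hs
    apply DifferentiableAt.differentiableWithinAt
    fun_prop
  refine hA.eqOn_of_preconnected_of_eventuallyEq hB (convex_halfSpace_re_gt 0).isPreconnected
    (z₀ := 2) (by simp) ?_ hs
  have ho1 : IsOpen {s : ℂ | 1 < s.re} := isOpen_lt continuous_const Complex.continuous_re
  filter_upwards [ho1.mem_nhds (show (2:ℂ) ∈ {s : ℂ | 1 < s.re} by simp)] with s hs
  have hs : 1 < s.re := hs
  have hs1 : s ≠ 1 := by rintro rfl; simp at hs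
  rw [Zf_ne hs1, zeta_Phi hs]
  have := sub_ne_zero.mpr hs1
  field_simp

lemma Zf_ne_zero_re_ge {s : ℂ} (hs : 1 ≤ s.re) : Zf s ≠ 0 := by
  by_cases h : s = 1
  · rw [h, Zf_one]; exact one_ne_zero
  · rw [Zf_ne h]
    exact mul_ne_zero (sub_ne_zero.mpr h) (riemannZeta_ne_zero_of_one_le_re hs)

lemma Zf_real {σ : ℝ} (hσ : 0 < σ) : Zf σ ≠ 0 := by
  by_cases h : 1 ≤ σ
  · exact Zf_ne_zero_re_ge (by simpa using h)
  push Not at h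
  rw [Zf_eq (by simpa using hσ)]
  have h1 : Phi σ = ((∫ t in Set.Ioi (1:ℝ), wfr t * t ^ (-σ) : ℝ) : ℂ) := by
    rw [Phi, ← integral_complex_ofReal]
    apply setIntegral_congr_fun measurableSet_Ioi
    intro t ht
    have ht : 1 < t := ht
    simp only
    push_cast
    rw [Complex.ofReal_cpow (by linarith)]
    push_cast; rfl
  have h2 : 0 ≤ ∫ t in Set.Ioi (1:ℝ), wfr t * t ^ (-σ) := by
    apply setIntegral_nonneg measurableSet_Ioi
    intro t ht
    have ht : 1 < t := ht
    exact mul_nonneg (wfr_nonneg t ht) (Real.rpow_nonneg (by linarith) _)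
  rw [h1]
  generalize (∫ t in Set.Ioi (1:ℝ), wfr t * t ^ (-σ)) = Q at h2
  have h3 : (σ : ℂ) - σ * (σ - 1) * Q = ((σ * (1 + (1 - σ) * Q) : ℝ) : ℂ) := by push_cast; ring
  rw [h3]
  have : 0 < σ * (1 + (1 - σ) * Q) := by
    have : 0 ≤ (1 - σ) * Q := mul_nonneg (by linarith) h2
    positivity
  exact_mod_cast this.ne'

lemma Zf_logderiv {s : ℂ} (hs : 1 < s.re) :
    deriv riemannZeta s / riemannZeta s = deriv Zf s / Zf s - 1 / (s - 1) := by
  have hs1 : s ≠ 1 := by rintro rfl; simp at hs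
  have h1 : Zf =ᶠ[nhds s] fun s => (s - 1) * riemannZeta s := by
    filter_upwards [isOpen_ne.mem_nhds hs1] with w hw using Zf_ne hw
  have h2 : HasDerivAt (fun s => (s - 1) * riemannZeta s)
      (1 * riemannZeta s + (s - 1) * deriv riemannZeta s) s :=
    ((hasDerivAt_id s).sub_const 1).mul (differentiableAt_riemannZeta hs1).hasDerivAt
  rw [h1.deriv_eq, h2.deriv, Zf_ne hs1]
  have h3 := riemannZeta_ne_zero_of_one_le_re hs.le
  have h4 := sub_ne_zero.mpr hs1
  field_simp
  ring

end ZetaReal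

section Assembly
open ProbabilityTheory

lemma half_ne {s a : ℂ} (h : a.re < s.re) : s - a ≠ 0 := by
  intro h0; have := congrArg Complex.re h0; simp at this; linarith

lemma two_re_pos : (0:ℝ) < 2 := by norm_num

noncomputable def Jf (s : ℂ) : ℂ := ∫ t in Set.Ioi (2:ℝ), ((1 / Real.log t : ℝ) : ℂ) * (t : ℂ) ^ (-s)

lemma invlog_nonneg (t : ℝ) (ht : 2 < t) : 0 ≤ 1 / Real.log t := by
  have := Real.log_pos (show 1 < t by linarith); positivity

lemma invlog_meas : Measurable fun t : ℝ => 1 / Real.log t := by fun_prop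

lemma invlog_int (σ : ℝ) (hσ : 1 < σ) :
    IntegrableOn (fun t => 1 / Real.log t * t ^ (-σ)) (Set.Ioi 2) := by
  have h := (integrableOn_Ioi_rpow_of_lt (show -σ < -1 by linarith) two_re_pos).const_mul (1 / Real.log 2)
  refine Integrable.mono' h ?_ ?_
  · exact (invlog_meas.mul (by fun_prop)).aestronglyMeasurable
  · filter_upwards [ae_restrict_mem measurableSet_Ioi] with t ht
    have ht : 2 < t := ht
    have ht0 : 0 < t := by linarith
    rw [norm_mul, Real.norm_eq_abs, Real.norm_eq_abs, abs_of_nonneg (invlog_nonneg t ht),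
      abs_of_pos (Real.rpow_pos_of_pos ht0 _)]
    apply mul_le_mul_of_nonneg_right _ (Real.rpow_nonneg ht0.le _)
    exact one_div_le_one_div_of_le (Real.log_pos (by norm_num)) (Real.log_le_log (by norm_num) ht.le)

lemma Jf_deriv {s : ℂ} (hs : 1 < s.re) : HasDerivAt Jf (-((2:ℂ) ^ (1 - s) / (s - 1))) s := by
  have h := dm_hasDerivAt two_re_pos invlog_meas.aemeasurable invlog_nonneg invlog_int hs
  refine HasDerivAt.congr_deriv (show HasDerivAt Jf _ s from h) ?_
  have h2 : ∀ t ∈ Set.Ioi (2:ℝ), -((1 / Real.log t * Real.log t : ℝ) : ℂ) * (t : ℂ) ^ (-s) =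
      -((t : ℂ) ^ (-s)) := by
    intro t ht
    have ht : 2 < t := ht
    have := (Real.log_pos (show 1 < t by linarith)).ne'
    rw [one_div_mul_cancel this]; simp
  rw [setIntegral_congr_fun measurableSet_Ioi h2, integral_neg,
    integral_Ioi_cpow_of_lt (by simpa using hs) two_re_pos]
  have h1 : s - 1 ≠ 0 := half_ne (by simpa using hs)
  have h3 : -s + 1 ≠ 0 := by intro h; apply h1; linear_combination -h
  rw [show (1 - s : ℂ) = -s + 1 by ring]
  push_cast
  generalize (2:ℂ) ^ (-s + 1) = Q
  field_simp
  ring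

lemma PiR_int {σ : ℝ} (hσ : 1 < σ) :
    IntegrableOn (fun t => PiR t * t ^ (-(σ + 1))) (Set.Ioi 2) := by
  have h := (integrableOn_Ioi_rpow_of_lt (show -σ < -1 by linarith) two_re_pos)
  refine Integrable.mono' h ?_ ?_
  · exact (PiR_mono.measurable.mul (by fun_prop)).aestronglyMeasurable
  · filter_upwards [ae_restrict_mem measurableSet_Ioi] with t ht
    have ht : 2 < t := ht
    have ht0 : 0 < t := by linarith
    rw [norm_mul, Real.norm_eq_abs, Real.norm_eq_abs, abs_of_nonneg (PiR_nonneg t),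
      abs_of_pos (Real.rpow_pos_of_pos ht0 _)]
    have e : t ^ (-σ) = t * t ^ (-(σ + 1)) := by
      nth_rewrite 2 [← Real.rpow_one t]
      rw [← Real.rpow_add ht0]; congr 1; ring
    rw [e]
    exact mul_le_mul_of_nonneg_right (PiR_le ht0.le) (Real.rpow_nonneg ht0.le _)

/-- Passing from real to complex powers. -/
lemma int_cpow {a : ℝ} (ha : 0 < a) {g : ℝ → ℝ} {z : ℂ}
    (hg : IntegrableOn (fun t => g t * t ^ (-z.re)) (Set.Ioi a)) :
    IntegrableOn (fun t : ℝ => (g t : ℂ) * (t : ℂ) ^ (-z)) (Set.Ioi a) := by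
  have hmem : ∀ᵐ t ∂(volume.restrict (Set.Ioi a)), a < t := ae_restrict_mem measurableSet_Ioi
  have hgm : AEStronglyMeasurable g (volume.restrict (Set.Ioi a)) := by
    have h1 : AEStronglyMeasurable (fun t : ℝ => (g t * t ^ (-z.re)) * t ^ z.re)
        (volume.restrict (Set.Ioi a)) :=
      hg.aestronglyMeasurable.mul (by fun_prop)
    refine h1.congr ?_
    filter_upwards [hmem] with t ht
    rw [mul_assoc, ← Real.rpow_add (ha.trans ht)]; simp
  refine Integrable.mono' hg.abs ?_ ?_
  · exact (Complex.continuous_ofReal.comp_aestronglyMeasurable hgm).mul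
      (Measurable.pow_const (by fun_prop) _).aestronglyMeasurable
  · filter_upwards [hmem] with t ht
    rw [norm_mul, Complex.norm_real, Complex.norm_cpow_eq_rpow_re_of_pos (ha.trans ht), abs_mul,
      abs_of_pos (Real.rpow_pos_of_pos (ha.trans ht) _)]
    simp

lemma D_int {σ : ℝ} (hσ : 1 < σ) :
    IntegrableOn (fun t => (PiR t - li t) * t ^ (-(σ + 1))) (Set.Ioi 2) := by
  have h1 := PiR_int hσ
  have h2 := (integrableOn_Ioi_rpow_of_lt (show -(σ + 1) < -1 by linarith) two_re_pos).const_mul (li 2)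
  have h3 := (fubini_prim (z := (σ : ℂ)) two_re_pos (by simpa using (by linarith : 0 < σ))
    (by simpa using invlog_int σ hσ)).1
  refine ((h1.sub h2).sub h3).congr ?_
  filter_upwards [ae_restrict_mem measurableSet_Ioi] with t ht
  have ht : 2 < t := ht
  simp only [Pi.sub_apply, Complex.ofReal_re]
  rw [li_eq ht.le]
  ring

lemma D_formula {s : ℂ} (hs : 1 < s.re) :
    ∫ t in Set.Ioi (2:ℝ), ((PiR t - li t : ℝ) : ℂ) * (t : ℂ) ^ (-(s + 1)) =
      (1 / s) * (LSeries (fun n => (bR n : ℂ)) s - li 2 * (2:ℂ) ^ (-s) - Jf s) := by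
  have hs0 : s ≠ 0 := by rintro rfl; simp at hs; linarith
  have hsr : (s + 1).re = s.re + 1 := by simp
  have h1 := int_cpow (z := s + 1) two_re_pos (by rw [hsr]; exact PiR_int hs)
  have h2 : IntegrableOn (fun t : ℝ => (li 2 : ℂ) * (t : ℂ) ^ (-(s + 1))) (Set.Ioi 2) :=
    (integrableOn_Ioi_cpow_of_lt (by simp; linarith) two_re_pos).const_mul _
  have hz : 0 < s.re := by linarith
  have h3 := (fubini_aux two_re_pos hz (invlog_int s.re hs))
  have e : ∀ t ∈ Set.Ioi (2:ℝ), ((PiR t - li t : ℝ) : ℂ) * (t : ℂ) ^ (-(s + 1)) =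
      ((PiR t : ℂ) * (t : ℂ) ^ (-(s + 1)) - (li 2 : ℂ) * (t : ℂ) ^ (-(s + 1))) -
      ((∫ u in (2:ℝ)..t, 1 / Real.log u : ℝ) : ℂ) * (t : ℂ) ^ (-(s + 1)) := by
    intro t ht
    have ht : 2 < t := ht
    rw [li_eq ht.le]
    push_cast
    ring
  rw [setIntegral_congr_fun measurableSet_Ioi e, 
    integral_sub (f := fun t : ℝ => (PiR t : ℂ) * (t : ℂ) ^ (-(s + 1)) - (li 2 : ℂ) * (t : ℂ) ^ (-(s + 1)))
      (h1.sub h2) h3.1, integral_sub h1 h2,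
    h3.2, integral_const_mul, integral_Ioi_cpow_of_lt (by simp; linarith) two_re_pos, G_int hs, ← Jf]
  rw [show -(s + 1) + 1 = -s by ring]
  push_cast
  field_simp

noncomputable def Af (c x : ℝ) : ℝ := ∫ t in (2:ℝ)..x, (PiR t - li t) / t ^ c

lemma g_int (c : ℝ) {σ : ℝ} (hσ : 1 < σ) :
    IntegrableOn (fun t => (PiR t - li t) / t ^ c * t ^ (-(σ + 1 - c))) (Set.Ioi 2) := by
  refine (D_int hσ).congr ?_
  filter_upwards [ae_restrict_mem measurableSet_Ioi] with t ht
  have ht : 2 < t := ht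
  have ht0 : 0 < t := by linarith
  rw [div_eq_mul_inv, ← Real.rpow_neg ht0.le, mul_assoc, ← Real.rpow_add ht0]
  congr 2; ring

lemma A_int {c σ : ℝ} (hc : c < 2) (hσ : 1 < σ) :
    IntegrableOn (fun x => Af c x * x ^ (-(σ + 1 - c + 1))) (Set.Ioi 2) := by
  have := (fubini_prim (z := ((σ + 1 - c : ℝ) : ℂ)) two_re_pos
    (by simp only [Complex.ofReal_re]; linarith)
    (by simp only [Complex.ofReal_re]; exact g_int c hσ)).1
  simp only [Complex.ofReal_re] at this
  exact this

lemma A_formula {c : ℝ} {s : ℂ} (hc : c < 2) (hs : 1 < s.re) :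
    ∫ x in Set.Ioi (2:ℝ), (Af c x : ℂ) * (x : ℂ) ^ (-(s + 1 - c + 1)) =
      (1 / (s + 1 - c)) * ((1 / s) *
        (LSeries (fun n => (bR n : ℂ)) s - li 2 * (2:ℂ) ^ (-s) - Jf s)) := by
  have hr : (s + 1 - c).re = s.re + 1 - c := by simp
  have h := (fubini_prim (z := s + 1 - c) two_re_pos (by rw [hr]; linarith)
    (by rw [hr]; exact g_int c hs)).2
  rw [← D_formula hs]
  unfold Af
  rw [h]
  congr 1
  apply setIntegral_congr_fun measurableSet_Ioi
  intro t ht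
  have ht : 2 < t := ht
  have ht0 : 0 < t := by linarith
  have ht1 : (t : ℂ) ≠ 0 := by exact_mod_cast ht0.ne'
  simp only
  rw [div_eq_mul_inv, ← Real.rpow_neg ht0.le, Complex.ofReal_mul, Complex.ofReal_cpow ht0.le,
    mul_assoc, ← Complex.cpow_add _ _ ht1]
  congr 2; push_cast; ring

lemma A_bound (c X : ℝ) : ∃ C : ℝ, 0 ≤ C ∧ ∀ x, 2 ≤ x → x ≤ X → |Af c x| ≤ C := by
  refine ⟨∫ t in Set.Ioc 2 X, |(PiR t - li t) / t ^ c|, integral_nonneg fun _ => abs_nonneg _, ?_⟩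
  intro x hx hxX
  have hi : IntegrableOn (fun t => (PiR t - li t) / t ^ c) (Set.Ioc 2 X) := by
    have h1 := (g_int c (σ := 2) (by norm_num)).mono_set (Set.Ioc_subset_Ioi_self : Set.Ioc 2 X ⊆ _)
    have h2 : ContinuousOn (fun t : ℝ => t ^ (2 + 1 - c)) (Set.Icc 2 X) := by
      intro t ht
      have : 0 < t := by linarith [ht.1]
      exact (Real.continuousAt_rpow_const t _ (Or.inl this.ne')).continuousWithinAt
    have h1' : IntegrableOn (fun t => (PiR t - li t) / t ^ c * t ^ (-((2:ℝ) + 1 - c))) (Set.Icc 2 X) :=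
      (integrableOn_Icc_iff_integrableOn_Ioc).2 h1
    have h3 := (h1'.mul_continuousOn h2 isCompact_Icc).mono_set Set.Ioc_subset_Icc_self
    refine h3.congr ?_
    filter_upwards [ae_restrict_mem measurableSet_Ioc] with t ht
    have : 0 < t := by linarith [ht.1]
    rw [mul_assoc, ← Real.rpow_add this]; simp
  rw [Af, intervalIntegral.integral_of_le hx]
  refine (abs_integral_le_integral_abs).trans ?_
  apply setIntegral_mono_set hi.abs (Eventually.of_forall fun _ => abs_nonneg _)
  exact (Set.Ioc_subset_Ioc_right hxX).eventuallyLE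

end Assembly

section Core
open ProbabilityTheory

noncomputable def wf (c β ε K x : ℝ) : ℝ := (K * x ^ (β + 1 - c) - ε * Af c x) * x ^ (c - 2)

lemma wf_rw (c β ε K : ℝ) (σ : ℝ) {x : ℝ} (hx : 2 < x) :
    wf c β ε K x * x ^ (-σ) = K * x ^ (-(σ + 1 - β)) - ε * (Af c x * x ^ (-(σ + 1 - c + 1))) := by
  have hx0 : 0 < x := by linarith
  have e1 : x ^ (-(σ + 1 - β)) = x ^ (β + 1 - c) * x ^ (c - 2) * x ^ (-σ) := by
    rw [← Real.rpow_add hx0, ← Real.rpow_add hx0]; congr 1; ring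
  have e2 : x ^ (-(σ + 1 - c + 1)) = x ^ (c - 2) * x ^ (-σ) := by
    rw [← Real.rpow_add hx0]; congr 1; ring
  rw [wf, e1, e2]; ring

lemma wf_rwc (c β ε K : ℝ) (s : ℂ) {x : ℝ} (hx : 2 < x) :
    (wf c β ε K x : ℂ) * (x : ℂ) ^ (-s) = K * (x : ℂ) ^ (-(s + 1 - β))
      - ε * (Af c x * (x : ℂ) ^ (-(s + 1 - c + 1))) := by
  have hx0 : 0 < x := by linarith
  have hx1 : (x : ℂ) ≠ 0 := by exact_mod_cast hx0.ne'
  have e1 : (x : ℂ) ^ (-(s + 1 - β)) = (x : ℂ) ^ ((β : ℂ) + 1 - c) * (x : ℂ) ^ ((c : ℂ) - 2) * (x : ℂ) ^ (-s) := by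
    rw [← Complex.cpow_add _ _ hx1, ← Complex.cpow_add _ _ hx1]; congr 1; ring
  have e2 : (x : ℂ) ^ (-(s + 1 - c + 1)) = (x : ℂ) ^ ((c : ℂ) - 2) * (x : ℂ) ^ (-s) := by
    rw [← Complex.cpow_add _ _ hx1]; congr 1; ring
  rw [wf, e1, e2]
  push_cast
  rw [Complex.ofReal_cpow hx0.le, Complex.ofReal_cpow hx0.le]
  push_cast
  ring

lemma wf_int {c β ε K σ : ℝ} (hc : c < 2) (hβ : β < 1) (hσ : 1 < σ) :
    IntegrableOn (fun x => wf c β ε K x * x ^ (-σ)) (Set.Ioi 2) := by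
  have h1 := (integrableOn_Ioi_rpow_of_lt (show -(σ + 1 - β) < -1 by linarith) two_re_pos).const_mul K
  have h2 := (A_int hc hσ).const_mul ε
  refine (h1.sub h2).congr ?_
  filter_upwards [ae_restrict_mem measurableSet_Ioi] with x hx
  exact (wf_rw c β ε K σ hx).symm

lemma wf_meas {c β ε K : ℝ} (hc : c < 2) (hβ : β < 1) :
    AEMeasurable (wf c β ε K) (volume.restrict (Set.Ioi 2)) := by
  have h1 := (wf_int (ε := ε) (K := K) hc hβ (show (1:ℝ) < 2 by norm_num)).aestronglyMeasurable.aemeasurable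
  have h2 : AEMeasurable (fun x : ℝ => x ^ (2:ℝ)) (volume.restrict (Set.Ioi 2)) := by fun_prop
  refine (h1.mul h2).congr ?_
  filter_upwards [ae_restrict_mem measurableSet_Ioi] with x hx
  have hx : 2 < x := hx
  simp only [Pi.mul_apply]
  rw [mul_assoc, ← Real.rpow_add (by linarith)]; simp

lemma wf_formula {c β ε K : ℝ} {s : ℂ} (hc : c < 2) (hβ : β < 1) (hs : 1 < s.re) :
    ∫ x in Set.Ioi (2:ℝ), (wf c β ε K x : ℂ) * (x : ℂ) ^ (-s) =
      K * ((2:ℂ) ^ (β - s) / (s - β)) - ε * ((1 / (s + 1 - c)) * ((1 / s) *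
        (LSeries (fun n => (bR n : ℂ)) s - li 2 * (2:ℂ) ^ (-s) - Jf s))) := by
  have hr : (-(s + 1 - β)).re < -1 := by simp; linarith
  have h1 : IntegrableOn (fun x : ℝ => (K : ℂ) * (x : ℂ) ^ (-(s + 1 - β))) (Set.Ioi 2) :=
    (integrableOn_Ioi_cpow_of_lt hr two_re_pos).const_mul _
  have h2 : IntegrableOn (fun x : ℝ => (ε : ℂ) * ((Af c x : ℂ) * (x : ℂ) ^ (-(s + 1 - c + 1)))) (Set.Ioi 2) := by
    apply Integrable.const_mul
    apply int_cpow two_re_pos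
    have : (s + 1 - c + 1).re = s.re + 1 - c + 1 := by simp
    rw [this]
    exact A_int hc hs
  rw [setIntegral_congr_fun measurableSet_Ioi (fun x hx => wf_rwc c β ε K s hx), integral_sub h1 h2,
    integral_const_mul, integral_const_mul, A_formula hc hs, integral_Ioi_cpow_of_lt hr two_re_pos]
  congr 2
  have h3 : s - β ≠ 0 := half_ne (by simp; linarith)
  rw [show -(s + 1 - β) + 1 = (β - s : ℂ) by ring]
  have h4 : (β - s : ℂ) ≠ 0 := by intro h; apply h3; linear_combination -h
  rw [show (s - β : ℂ) = -(β - s) by ring]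
  push_cast
  field_simp

lemma Zf_no_zero_of_ode {β : ℝ} {W : ℂ → ℂ} (hW : DifferentiableOn ℂ W {s : ℂ | β < s.re})
    (h : ∀ s : ℂ, β < s.re → deriv Zf s = Zf s * W s) {ρ : ℂ} (hρ : β < ρ.re) : Zf ρ ≠ 0 := by
  intro h0
  have ho : IsOpen {s : ℂ | β < s.re} := isOpen_lt continuous_const Complex.continuous_re
  obtain ⟨r, hr, hball⟩ := Metric.isOpen_iff.mp ho ρ hρ
  obtain ⟨P, hP⟩ := (hW.mono hball).isExactOn_ball
  have hd : ∀ s ∈ Metric.ball ρ r, HasDerivAt (fun s => Zf s * Complex.exp (-P s)) 0 s := by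
    intro s hs
    have h1 := (Zf_diff s).hasDerivAt.mul ((hP s hs).neg.cexp)
    refine HasDerivAt.congr_deriv (show HasDerivAt (fun s => Zf s * Complex.exp (-P s)) _ s from h1) ?_
    rw [h s (hball hs)]; ring
  obtain ⟨C, hC⟩ := Metric.isOpen_ball.exists_is_const_of_deriv_eq_zero
      (convex_ball ρ r).isPreconnected
      (fun s hs => (hd s hs).differentiableAt.differentiableWithinAt) (fun s hs => (hd s hs).deriv)
  have hC0 : C = 0 := by
    rw [← hC ρ (Metric.mem_ball_self hr), h0, zero_mul]
  have hz : ∀ s ∈ Metric.ball ρ r, Zf s = 0 := by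
    intro s hs
    have := hC s hs
    rw [hC0] at this
    exact (mul_eq_zero.mp this).resolve_right (Complex.exp_ne_zero _)
  have hA : AnalyticOnNhd ℂ Zf Set.univ := fun s _ => Zf_diff.analyticAt s
  have hall := hA.eqOn_zero_of_preconnected_of_eventuallyEq_zero isPreconnected_univ
    (Set.mem_univ ρ) (by
      filter_upwards [Metric.ball_mem_nhds ρ hr] with s hs using hz s hs)
  have := hall (Set.mem_univ 1)
  rw [Zf_one] at this
  exact one_ne_zero this

lemma two_cpow_deriv {f : ℂ → ℂ} {f' s : ℂ} (hf : HasDerivAt f f' s) :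
    HasDerivAt (fun s => (2:ℂ) ^ (f s)) ((2:ℂ) ^ (f s) * Complex.log 2 * f') s :=
  hf.const_cpow (Or.inl two_ne_zero)

lemma core {c β ε K : ℝ} (hε : ε * ε = 1) (hβ0 : 0 < β) (hβ1 : β < 1) (hα : 0 < β + 1 - c)
    (hA : ∀ x, 2 ≤ x → ε * Af c x ≤ K * x ^ (β + 1 - c)) {ρ : ℂ} (hρ : β < ρ.re) : Zf ρ ≠ 0 := by
  have hc : c < 2 := by linarith
  have hεc : (ε : ℂ) * ε = 1 := by exact_mod_cast hε
  have hε0 : (ε : ℂ) ≠ 0 := left_ne_zero_of_mul_eq_one hεc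
  have hm := wf_meas (ε := ε) (K := K) hc hβ1
  have h0 : ∀ t, 2 < t → 0 ≤ wf c β ε K t := by
    intro t ht
    have := hA t ht.le
    exact mul_nonneg (by linarith) (Real.rpow_nonneg (by linarith) _)
  set μ := dm 2 (wf c β ε K) with hμ
  have hs1 : Set.Ioi (1:ℝ) ⊆ integrableExpSet nlog μ := fun σ hσ =>
    (dm_mem two_re_pos hm h0 σ).mpr (wf_int hc hβ1 hσ)
  have hoβ : IsOpen {s : ℂ | β < s.re} := isOpen_lt continuous_const Complex.continuous_re
  have ho1 : IsOpen {s : ℂ | 1 < s.re} := isOpen_lt continuous_const Complex.continuous_re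
  let V : ℂ → ℂ := fun s => ε * (s * (s + 1 - c))
  let E1 : ℂ → ℂ := fun s => ε * K * (s * (s + 1 - c)) * ((2:ℂ) ^ (β - s) / (s - β))
  let Q : ℂ → ℂ := dslope (fun s => (2:ℂ) ^ (1 - s)) 1
  let R : ℂ → ℂ := fun s => deriv E1 s - Q s - li 2 * ((2:ℂ) ^ (-s) * Complex.log 2)
  let M : ℂ → ℂ := fun s => R s - deriv Zf s / Zf s
  have hV : Differentiable ℂ V := by intro s; simp only [V]; fun_prop
  have h2pow : ∀ a : ℂ, Differentiable ℂ fun s => (2:ℂ) ^ (a - s) := fun a s =>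
    (two_cpow_deriv ((hasDerivAt_id s).const_sub a)).differentiableAt
  have h2neg : Differentiable ℂ fun s : ℂ => (2:ℂ) ^ (-s) := fun s =>
    (two_cpow_deriv ((hasDerivAt_id s).neg)).differentiableAt
  have hE1 : ∀ s : ℂ, β < s.re → DifferentiableAt ℂ E1 s := by
    intro s hs
    have h3 : s - β ≠ 0 := half_ne (by simpa using hs)
    have h4 := h2pow β s
    simp only [E1]
    exact DifferentiableAt.mul (by fun_prop) (h4.div (by fun_prop) h3)
  have hE1a : ∀ s : ℂ, β < s.re → AnalyticAt ℂ E1 s := fun s hs =>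
    (DifferentiableOn.analyticOnNhd (fun s hs => (hE1 s hs).differentiableWithinAt) hoβ) s hs
  have hQ : Differentiable ℂ Q := by
    rw [← differentiableOn_univ]
    exact (Complex.differentiableOn_dslope univ_mem).mpr (h2pow 1).differentiableOn
  have hQe : ∀ s : ℂ, 1 < s.re → Q s = ((2:ℂ) ^ (1 - s) - 1) / (s - 1) := by
    intro s hs
    have hs1 : s ≠ 1 := by rintro rfl; simp at hs
    simp only [Q]
    rw [dslope_of_ne _ hs1, slope_def_field]
    simp
  have hR : ∀ s : ℂ, β < s.re → AnalyticAt ℂ R s := by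
    intro s hs
    exact ((hE1a s hs).deriv.sub (hQ.analyticAt s)).sub
      (analyticAt_const.mul ((h2neg.analyticAt s).mul analyticAt_const))
  have hZd : ∀ s, AnalyticAt ℂ (deriv Zf) s := fun s => (Zf_diff.analyticAt s).deriv
  have hM : ∀ σ : ℝ, β < σ → AnalyticAt ℂ M σ := by
    intro σ hσ
    exact (hR σ (by simpa using hσ)).sub ((hZd σ).div (Zf_diff.analyticAt _) (Zf_real (hβ0.trans hσ)))
  have hV0 : ∀ σ : ℝ, β < σ → V σ ≠ 0 := by
    intro σ hσ
    have : (σ : ℂ) * (σ + 1 - c) = ((σ * (σ + 1 - c) : ℝ) : ℂ) := by push_cast; ring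
    simp only [V]
    rw [this]
    refine mul_ne_zero hε0 ?_
    have h1 : 0 < σ := by linarith
    have h2 : 0 < σ + 1 - c := by linarith
    exact_mod_cast (mul_pos h1 h2).ne'
  have hVF : ∀ s : ℂ, 1 < s.re → V s * complexMGF nlog μ s =
      E1 s - LSeries (fun n => (bR n : ℂ)) s + li 2 * (2:ℂ) ^ (-s) + Jf s := by
    intro s hs
    rw [hμ, dm_mgf two_re_pos hm h0, wf_formula hc hβ1 hs]
    have h1 : s - β ≠ 0 := half_ne (by simp; linarith)
    have h2 : s ≠ 0 := by rintro rfl; simp at hs; linarith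
    have h3 : s + 1 - c ≠ 0 := by
      intro h; have := congrArg Complex.re h; simp at this; linarith
    simp only [V, E1]
    generalize LSeries (fun n => (bR n : ℂ)) s = G
    generalize (2:ℂ) ^ (β - s) = p
    generalize (2:ℂ) ^ (-s) = q
    generalize Jf s = j
    have e : (ε : ℂ) * (s * (s + 1 - c)) * (ε * ((1 / (s + 1 - c)) * ((1 / s) * (G - li 2 * q - j)))) =
        G - li 2 * q - j := by
      calc _ = ((ε : ℂ) * ε) * (s * (1 / s)) * ((s + 1 - c) * (1 / (s + 1 - c))) * (G - li 2 * q - j) := by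
            ring
        _ = _ := by rw [hεc, mul_one_div_cancel h2, mul_one_div_cancel h3]; ring
    rw [mul_sub, e]
    ring
  have hder : ∀ s : ℂ, 1 < s.re → HasDerivAt (fun s => V s * complexMGF nlog μ s) (M s) s := by
    intro s hs
    have hE := (hE1 s (by linarith)).hasDerivAt
    have hG := G_deriv hs
    have hJ := Jf_deriv hs
    have hL := (two_cpow_deriv ((hasDerivAt_id s).neg)).const_mul (li 2 : ℂ)
    have hT := ((hE.sub hG).add hL).add hJ
    have hev : (fun s => V s * complexMGF nlog μ s) =ᶠ[nhds s]
        (fun s => E1 s - LSeries (fun n => (bR n : ℂ)) s + li 2 * (2:ℂ) ^ (-s) + Jf s) := by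
      filter_upwards [ho1.mem_nhds hs] with w hw using hVF w hw
    refine (HasDerivAt.congr_deriv hT ?_).congr_of_eventuallyEq hev
    simp only [M, R]
    rw [hQe s hs, Zf_logderiv hs]
    simp only [Pi.neg_apply, id]
    ring
  have hI := landau measurable_nlog.aemeasurable (dm_nonpos (by norm_num) _) hs1 hV hV0 hM hder
  have hFan : ∀ s : ℂ, β < s.re → AnalyticAt ℂ (complexMGF nlog μ) s := fun s hs =>
    analyticAt_complexMGF ((interior_maximal hI isOpen_Ioi) hs)
  let W : ℂ → ℂ := fun s => R s - deriv (fun s => V s * complexMGF nlog μ s) s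
  have hWa : AnalyticOnNhd ℂ W {s : ℂ | β < s.re} := fun s hs =>
    (hR s hs).sub ((hV.analyticAt s).mul (hFan s hs)).deriv
  refine Zf_no_zero_of_ode (W := W) (fun s hs => (hWa s hs).differentiableAt.differentiableWithinAt) ?_ hρ
  have hL : AnalyticOnNhd ℂ (deriv Zf) {s : ℂ | β < s.re} := fun s _ => hZd s
  have hRt : AnalyticOnNhd ℂ (fun s => Zf s * W s) {s : ℂ | β < s.re} := fun s hs =>
    (Zf_diff.analyticAt s).mul (hWa s hs)
  refine hL.eqOn_of_preconnected_of_eventuallyEq hRt (convex_halfSpace_re_gt β).isPreconnected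
    (z₀ := 2) (by simp; linarith) ?_
  filter_upwards [ho1.mem_nhds (show (2:ℂ) ∈ {s : ℂ | 1 < s.re} by simp)] with s hs
  have hs : 1 < s.re := hs
  have hz := Zf_ne_zero_re_ge hs.le
  simp only [W]
  rw [(hder s hs).deriv]
  simp only [M]
  field_simp
  ring

lemma omegaZ_bdd : BddAbove {r : ℝ | ∃ s : ℂ, riemannZeta s = 0 ∧ s.re = r} := by
  refine ⟨1, ?_⟩
  rintro r ⟨s, hs, rfl⟩
  by_contra h
  push Not at h
  exact riemannZeta_ne_zero_of_one_le_re h.le hs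

lemma omegaZ_ge : 1 / 2 ≤ omegaZ := by
  obtain ⟨s, hs, hre⟩ := exists_nontrivial_zero
  exact hre.trans (le_csSup omegaZ_bdd ⟨s, hs, rfl⟩)

lemma exists_Zf_zero {β : ℝ} (hβ : β < omegaZ) : ∃ ρ : ℂ, β < ρ.re ∧ Zf ρ = 0 := by
  obtain ⟨s0, hs0, -⟩ := exists_nontrivial_zero
  have hne : {r : ℝ | ∃ s : ℂ, riemannZeta s = 0 ∧ s.re = r}.Nonempty := ⟨s0.re, s0, hs0, rfl⟩
  obtain ⟨r, ⟨s, hs, rfl⟩, hr⟩ := exists_lt_of_lt_csSup hne hβ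
  have h1 : s ≠ 1 := by
    rintro rfl
    exact riemannZeta_ne_zero_of_one_le_re (by simp) hs
  exact ⟨s, hr, by rw [Zf_ne h1, hs, mul_zero]⟩

/-- The one-sided oscillation statement. -/
lemma oscillate {c : ℝ} (hc : c < 1 + omegaZ) (homega : 1 + omegaZ ≤ 2) {ε : ℝ} (hε : ε * ε = 1)
    {δ : ℝ} (hδ : 0 < δ) (X : ℝ) :
    ∃ x : ℝ, x > X ∧ ε * Af c x > 1 * x ^ (1 + omegaZ - c - δ) := by
  by_contra hcon
  push Not at hcon
  have hω := omegaZ_ge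
  obtain ⟨η, hη0, hηδ, hη1, hη2⟩ : ∃ η : ℝ, 0 < η ∧ η ≤ δ ∧ η < omegaZ ∧ η < 1 + omegaZ - c := by
    have hq : 0 < min δ (min (omegaZ / 2) ((1 + omegaZ - c) / 2)) :=
      lt_min hδ (lt_min (by linarith) (by linarith))
    refine ⟨min δ (min (omegaZ / 2) ((1 + omegaZ - c) / 2)), hq, min_le_left _ _, ?_, ?_⟩
    · have := (min_le_right δ (min (omegaZ / 2) ((1 + omegaZ - c) / 2))).trans (min_le_left _ _)
      linarith
    · have := (min_le_right δ (min (omegaZ / 2) ((1 + omegaZ - c) / 2))).trans (min_le_right _ _)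
      linarith
  obtain ⟨C, hC0, hC⟩ := A_bound c X
  have habs : |ε| = 1 := by
    have : |ε| * |ε| = 1 := by rw [← abs_mul, hε, abs_one]
    nlinarith [abs_nonneg ε]
  obtain ⟨ρ, hρ, hρ0⟩ := exists_Zf_zero (show omegaZ - η < omegaZ by linarith)
  refine core (c := c) (β := omegaZ - η) (K := 1 + C) hε (by linarith) (by linarith) (by linarith) ?_ hρ hρ0
  intro x hx
  have h1 : 1 ≤ x ^ (omegaZ - η + 1 - c) := Real.one_le_rpow (by linarith) (by linarith)
  rcases le_or_gt x X with h | h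
  · have h2 : ε * Af c x ≤ C := by
      calc ε * Af c x ≤ |ε * Af c x| := le_abs_self _
        _ = |Af c x| := by rw [abs_mul, habs, one_mul]
        _ ≤ C := hC x hx h
    nlinarith
  · have h2 := hcon x h
    have h3 : x ^ (1 + omegaZ - c - δ) ≤ x ^ (omegaZ - η + 1 - c) :=
      Real.rpow_le_rpow_of_exponent_le (by linarith) (by linarith)
    nlinarith

end Core

theorem integral_Pi_sub_li_div_rpow_omega_pm
    (c : ℝ) (hc : c < 1 + omegaZ) (homega : 1 + omegaZ ≤ 2) :
    ∀ δ : ℝ, δ > 0 → ∃ K : ℝ, K > 0 ∧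
      (∀ X : ℝ, ∃ x : ℝ, x > X ∧
        (∫ t in (2:ℝ)..x, (PiR t - li t) / t ^ c) > K * x ^ (1 + omegaZ - c - δ)) ∧
      (∀ X : ℝ, ∃ x : ℝ, x > X ∧
        (∫ t in (2:ℝ)..x, (PiR t - li t) / t ^ c) < -(K * x ^ (1 + omegaZ - c - δ))) := by

  intro δ hδ
  refine ⟨1, one_pos, fun X => ?_, fun X => ?_⟩
  · obtain ⟨x, hx, h⟩ := oscillate hc homega (ε := 1) (by norm_num) hδ X
    rw [one_mul (Af c x)] at h
    exact ⟨x, hx, h⟩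
  · obtain ⟨x, hx, h⟩ := oscillate hc homega (ε := -1) (by norm_num) hδ X
    refine ⟨x, hx, ?_⟩
    change Af c x < _
    linarith
end

section
/- Let c be a real number and suppose c < 1 + ω ≤ 2, where ω = sup{Re(s) : ζ(s) = 0}. Then for every δ > 0 there is a constant K > 0 such that there are arbitrarily large x with ∫_2^x (ψ(t) − t)/t^c dt > K·x^{1+ω−c−δ}, and also arbitrarily large x with ∫_2^x (ψ(t) − t)/t^c dt < −K·x^{1+ω−c−δ}. -/
open MeasureTheory Filter

/-- `psi x = ∑_{p^m ≤ x} log p`, the Chebyshev psi function. -/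
noncomputable def psi (x : ℝ) : ℝ :=
  ∑ n ∈ Finset.Icc 1 ⌊x⌋₊, ArithmeticFunction.vonMangoldt n

namespace ZetaOmega
open Complex HurwitzZeta Topology

lemma evenKernel_zero_sub_one_nonneg {t : ℝ} (ht : 0 < t) : 0 ≤ evenKernel 0 t - 1 := by
  have h := hasSum_int_evenKernel₀ 0 ht
  simp only [QuotientAddGroup.mk_zero, if_true] at h
  refine h.nonneg fun n => ?_
  split_ifs <;> positivity

lemma f_modif_norm {t : ℝ} (ht : 0 < t) :
    ((‖(hurwitzEvenFEPair 0).f_modif t‖ : ℝ) : ℂ) = (hurwitzEvenFEPair 0).f_modif t := by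
  suffices h : ∃ r : ℝ, 0 ≤ r ∧ (hurwitzEvenFEPair 0).f_modif t = r by
    obtain ⟨r, hr, h⟩ := h
    rw [h, Complex.norm_real, Real.norm_of_nonneg hr]
  rcases lt_trichotomy t 1 with h | h | h
  · refine ⟨evenKernel 0 t - t ^ (-(1/2) : ℝ), ?_, ?_⟩
    · rw [evenKernel_functional_equation, ← evenKernel_eq_cosKernel_of_zero,
        Real.rpow_neg ht.le]
      have := evenKernel_zero_sub_one_nonneg (one_div_pos.2 ht)
      have h2 : 0 ≤ 1 / t ^ (1/2 : ℝ) := by positivity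
      have := mul_nonneg h2 this
      rw [mul_sub, mul_one] at this
      simpa using this
    · simp [WeakFEPair.f_modif, h, ht, hurwitzEvenFEPair, h.le]
  · refine ⟨0, le_rfl, ?_⟩
    simp [WeakFEPair.f_modif, h]
  · refine ⟨evenKernel 0 t - 1, evenKernel_zero_sub_one_nonneg ht, ?_⟩
    simp [WeakFEPair.f_modif, h, hurwitzEvenFEPair, h.le]

lemma L0_eq (s : ℂ) : completedRiemannZeta₀ s = mellin (hurwitzEvenFEPair 0).f_modif (s / 2) / 2 :=
  rfl

lemma mconv (s : ℂ) : MellinConvergent (hurwitzEvenFEPair 0).f_modif s :=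
  ((hurwitzEvenFEPair 0).isStrongFEPair_toStrongFEPair.hasMellin s).1

lemma L0_real (x : ℝ) : ‖completedRiemannZeta₀ x‖ =
    (∫ t in Set.Ioi (0:ℝ), t ^ (x / 2 - 1) * ‖(hurwitzEvenFEPair 0).f_modif t‖) / 2 := by
  have : completedRiemannZeta₀ x =
    (((∫ t in Set.Ioi (0:ℝ), t ^ (x / 2 - 1) * ‖(hurwitzEvenFEPair 0).f_modif t‖) / 2 : ℝ) : ℂ) := by
    rw [L0_eq, mellin]
    push_cast
    rw [← integral_complex_ofReal]
    congr 1
    refine setIntegral_congr_fun measurableSet_Ioi fun t ht => ?_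
    have ht : 0 < t := ht
    simp only [smul_eq_mul, ofReal_mul]
    rw [f_modif_norm ht, ofReal_cpow ht.le]
    push_cast; rfl
  rw [this, Complex.norm_real, Real.norm_of_nonneg]
  refine div_nonneg (setIntegral_nonneg measurableSet_Ioi fun t ht => ?_) two_pos.le
  have ht : 0 < t := ht
  positivity

lemma int_real (x : ℝ) : IntegrableOn
    (fun t => t ^ (x / 2 - 1) * ‖(hurwitzEvenFEPair 0).f_modif t‖) (Set.Ioi (0:ℝ)) := by
  have h := (mconv (x/2 : ℝ)).norm
  refine (integrableOn_congr_fun (fun t ht => ?_) measurableSet_Ioi).1 h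
  have ht : 0 < t := ht
  simp [norm_cpow_eq_rpow_re_of_pos ht]

lemma L0_norm_le (s : ℂ) (n : ℕ) (hs : |s.re| ≤ 2 * n - 1) :
    ‖completedRiemannZeta₀ s‖ ≤ 2 * ‖completedRiemannZeta₀ (2 * n : ℕ)‖ := by
  have e1 : ‖completedRiemannZeta₀ (((1 - 2 * n : ℝ)) : ℂ)‖ =
      ‖completedRiemannZeta₀ (2 * n : ℕ)‖ := by
    rw [← completedRiemannZeta₀_one_sub]; congr 2; push_cast; ring
  have e2 : ‖completedRiemannZeta₀ (((2 * n : ℝ)) : ℂ)‖ =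
      ‖completedRiemannZeta₀ (2 * n : ℕ)‖ := by
    congr 2; push_cast; ring
  rw [abs_le] at hs
  rw [two_mul]
  nth_rw 1 [← e1]
  rw [← e2, L0_real, L0_real, ← add_div, ← integral_add (int_real _) (int_real _), L0_eq, norm_div,
    mellin]
  simp only [Complex.norm_ofNat]
  gcongr
  refine (norm_integral_le_integral_norm _).trans ?_
  refine setIntegral_mono_on (mconv _).norm ((int_real _).add (int_real _)) measurableSet_Ioi
    fun t ht => ?_
  have ht : 0 < t := ht
  rw [norm_smul, norm_cpow_eq_rpow_re_of_pos ht, ← add_mul]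
  gcongr
  have h0 : (s / 2 - 1).re = s.re / 2 - 1 := by simp
  rw [h0]
  rcases le_total t 1 with h | h
  · refine le_trans (Real.rpow_le_rpow_of_exponent_ge ht h ?_)
      (le_add_of_nonneg_right (by positivity))
    linarith
  · refine le_trans (Real.rpow_le_rpow_of_exponent_le h ?_)
      (le_add_of_nonneg_left (by positivity))
    linarith

lemma L0_even_le (n : ℕ) (hn : 1 ≤ n) : ‖completedRiemannZeta₀ (2 * n : ℕ)‖ ≤ 4 * (n:ℝ) ^ n := by
  have hn' : (1:ℝ) ≤ n := by exact_mod_cast hn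
  have h1 : completedRiemannZeta₀ (2 * n : ℕ) =
    completedRiemannZeta (2 * n : ℕ) + 1 / (2 * n : ℕ) + 1 / (1 - (2 * n : ℕ)) := by
    rw [completedRiemannZeta_eq]; ring
  have hre : 1 < ((2 * n : ℕ) : ℂ).re := by
    rw [Complex.natCast_re]; push_cast; linarith
  have hz : ‖∑' k : ℕ, 1 / (k : ℂ) ^ ((2 * n : ℕ) : ℂ)‖ ≤ 2 := by
    have hs : HasSum (fun k : ℕ => 1 / (k : ℝ) ^ 2) (Real.pi ^ 2 / 6) := hasSum_zeta_two
    have hb : ∀ k : ℕ, ‖1 / (k : ℂ) ^ ((2 * n : ℕ) : ℂ)‖ ≤ 1 / (k:ℝ) ^ 2 := by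
      intro k
      rw [cpow_natCast, norm_div, norm_pow, norm_one, Complex.norm_natCast]
      rcases Nat.eq_zero_or_pos k with rfl | hk
      · have : 2 * n ≠ 0 := by omega
        simp [this]
      · have : (1:ℝ) ≤ k := by exact_mod_cast hk
        exact one_div_le_one_div_of_le (by positivity) (pow_le_pow_right₀ this (by omega))
    refine (tsum_of_norm_bounded hs hb).trans ?_
    nlinarith [Real.pi_lt_d2, Real.pi_pos]
  have hL : ‖completedRiemannZeta (2 * n : ℕ)‖ ≤ 2 * (n:ℝ)^n := by
    rw [completedZeta_eq_tsum_of_one_lt_re hre, norm_mul, norm_mul, mul_comm (2:ℝ)]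
    refine mul_le_mul ?_ hz (norm_nonneg _) (by positivity)
    have e : ((2 * n : ℕ) : ℂ) / 2 = ((n - 1 : ℕ) : ℂ) + 1 := by
      rw [Nat.cast_sub hn]; push_cast; ring
    rw [e, Gamma_nat_eq_factorial, Complex.norm_natCast]
    have h2 : ‖(Real.pi : ℂ) ^ (-((2 * n : ℕ) : ℂ) / 2)‖ ≤ 1 := by
      rw [norm_cpow_eq_rpow_re_of_pos Real.pi_pos]
      apply Real.rpow_le_one_of_one_le_of_nonpos
      · linarith [Real.pi_gt_three]
      · have : (-((2 * n : ℕ) : ℂ) / 2).re = -n := by simp; ring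
        rw [this]; linarith
    have h3 : ((n - 1).factorial : ℝ) ≤ (n:ℝ)^n := by
      have : (n-1).factorial ≤ n ^ n :=
        (Nat.factorial_le (Nat.sub_le n 1)).trans (Nat.factorial_le_pow n)
      exact_mod_cast this
    calc _ ≤ 1 * (n:ℝ)^n := by gcongr
      _ = _ := one_mul _
  have hp : (1:ℝ) ≤ (n:ℝ)^n := one_le_pow₀ hn'
  have ha : ‖(1:ℂ) / (2 * n : ℕ)‖ ≤ 1 := by
    rw [norm_div, Complex.norm_natCast, norm_one]
    apply div_le_one_of_le₀ <;> push_cast <;> linarith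
  have hb : ‖(1:ℂ) / (1 - (2 * n : ℕ))‖ ≤ 1 := by
    have : (1:ℂ) - (2 * n : ℕ) = ((1 - 2 * n : ℝ) : ℂ) := by push_cast; ring
    rw [norm_div, this, Complex.norm_real, norm_one, Real.norm_eq_abs, abs_of_neg (by linarith)]
    apply div_le_one_of_le₀ <;> linarith
  rw [h1]
  calc _ ≤ ‖completedRiemannZeta (2 * n : ℕ)‖ + ‖(1:ℂ) / (2 * n : ℕ)‖ +
      ‖(1:ℂ) / (1 - (2 * n : ℕ))‖ := norm_add₃_le
    _ ≤ _ := by linarith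

/-- entire xi function (up to normalization) -/
noncomputable def xiF (s : ℂ) : ℂ := s * (1 - s) * completedRiemannZeta₀ s - 1

lemma xiF_diff : Differentiable ℂ xiF := by
  have := differentiable_completedZeta₀
  unfold xiF; fun_prop

lemma xiF_symm (s : ℂ) : xiF (1 - s) = xiF s := by
  unfold xiF; rw [completedRiemannZeta₀_one_sub]; ring

lemma xiF_bound (n : ℕ) (hn : 1 ≤ n) (s : ℂ) (hs : ‖s‖ ≤ n) :
    ‖xiF s‖ ≤ 17 * (n:ℝ) ^ (n + 2) := by
  have hn' : (1:ℝ) ≤ n := by exact_mod_cast hn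
  have h1 := L0_norm_le s n ((abs_re_le_norm s).trans (by linarith))
  have h2 := L0_even_le n hn
  have hp : (1:ℝ) ≤ (n:ℝ)^(n+2) := one_le_pow₀ hn'
  have h3 : ‖1 - s‖ ≤ 2 * n := (norm_sub_le _ _).trans (by rw [norm_one]; linarith)
  unfold xiF
  calc _ ≤ ‖s * (1 - s) * completedRiemannZeta₀ s‖ + ‖(1:ℂ)‖ := norm_sub_le _ _
    _ = ‖s‖ * ‖1 - s‖ * ‖completedRiemannZeta₀ s‖ + 1 := by simp
    _ ≤ n * (2 * n) * (2 * (4 * (n:ℝ)^n)) + 1 := by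
      gcongr; linarith
    _ = 16 * (n:ℝ) ^ (n+2) + 1 := by ring
    _ ≤ _ := by linarith

lemma log_xiF (n : ℕ) (hn : 1 ≤ n) (s : ℂ) (hs : ‖s‖ ≤ n) (h0 : xiF s ≠ 0) :
    Real.log ‖xiF s‖ ≤ 23 * (n * Real.sqrt n) := by
  have hn' : (1:ℝ) ≤ n := by exact_mod_cast hn
  have h1 : Real.log ‖xiF s‖ ≤ Real.log (17 * (n:ℝ)^(n+2)) :=
    Real.log_le_log (norm_pos_iff.2 h0) (xiF_bound n hn s hs)
  have hq : 1 ≤ Real.sqrt n := Real.one_le_sqrt.2 hn'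
  have h2 : Real.log n ≤ 2 * Real.sqrt n := by
    have := Real.log_le_self (Real.sqrt_nonneg (n:ℝ))
    rw [Real.log_sqrt (by linarith)] at this
    linarith
  have h3 : Real.log 17 ≤ 17 := Real.log_le_self (by norm_num)
  rw [Real.log_mul (by norm_num) (by positivity), Real.log_pow] at h1
  have h4 : ((n + 2 : ℕ) : ℝ) * Real.log n ≤ (3 * n) * (2 * Real.sqrt n) := by
    gcongr
    push_cast; linarith
  nlinarith

lemma exists_log (f : ℂ → ℂ) (hf : Differentiable ℂ f) (h0 : ∀ s, f s ≠ 0) :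
    ∃ g : ℂ → ℂ, Differentiable ℂ g ∧ ∀ s, f s = cexp (g s) := by
  have hd : Differentiable ℂ (fun s => deriv f s / f s) :=
    (hf.contDiff (n := 2)).differentiable_deriv_two.div hf h0 
  obtain ⟨g, hg0, hg⟩ := hd.isExactOn_univ.with_val_at 0 (log (f 0))
  have hg' : ∀ s, HasDerivAt g (deriv f s / f s) s := fun s => hg s trivial
  refine ⟨g, fun s => (hg' s).differentiableAt, fun s => ?_⟩
  have hc : ∀ s, HasDerivAt (fun s => f s * cexp (-g s)) 0 s := by
    intro s
    have := (hf s).hasDerivAt.mul (hg' s).neg.cexp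
    convert! this using 1
    field_simp [h0 s]
    ring
  have := is_const_of_deriv_eq_zero (fun s => (hc s).differentiableAt) (fun s => (hc s).deriv) s 0
  simp only [hg0, Complex.exp_neg, exp_log (h0 0)] at this
  rw [mul_inv_cancel₀ (h0 0)] at this
  field_simp at this
  exact this

lemma exists_xiF_zero : ∃ s, xiF s = 0 := by
  by_contra hcon
  push Not at hcon
  obtain ⟨g, hg, hfg⟩ := exists_log xiF xiF_diff hcon
  have hre : ∀ (n : ℕ), 1 ≤ n → ∀ s : ℂ, ‖s‖ ≤ n → (g s).re ≤ 23 * (n * Real.sqrt n) := by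
    intro n hn s hs
    have := log_xiF n hn s hs (hcon s)
    rwa [hfg, Complex.norm_exp, Real.log_exp] at this
  have hB : ∀ (m : ℕ), 1 ≤ m → ∀ z ∈ Metric.sphere (0:ℂ) m,
      ‖g z‖ ≤ (200 + 3 * ‖g 0‖) * (m * Real.sqrt m) := by
    intro m hm z hz
    have hm' : (1:ℝ) ≤ m := by exact_mod_cast hm
    have hz : ‖z‖ = m := by simpa using hz
    have hq : 1 ≤ Real.sqrt m := Real.one_le_sqrt.2 hm'
    have hq2 : Real.sqrt ((2 * m : ℕ) : ℝ) ≤ 2 * Real.sqrt m := by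
      rw [Real.sqrt_le_left (by positivity), mul_pow, Real.sq_sqrt (by positivity)]
      push_cast; linarith
    have := borelCaratheodory (M := 23 * ((2 * m : ℕ) * Real.sqrt (2 * m : ℕ))) (f := g)
      (R := 2 * m) (z := z) (by positivity) hg.differentiableOn
      (fun s hs => hre (2 * m) (by omega) s (by
        have : ‖s‖ < 2 * m := by simpa using hs
        push_cast; exact this.le)) (by positivity) (by simp [hz]; linarith)
    rw [hz] at this
    have e1 : (2 * m - m : ℝ) = m := by ring
    have e2 : (2 * m + m : ℝ) = 3 * m := by ring
    rw [e1, e2, mul_div_assoc, mul_div_assoc, mul_div_assoc, div_self (by positivity)] at this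
    have h5 : ((2 * m : ℕ):ℝ) * Real.sqrt (2 * m : ℕ) ≤ (2 * m) * (2 * Real.sqrt m) := by
      push_cast at hq2 ⊢; gcongr
    have h6 : 1 ≤ m * Real.sqrt m := by nlinarith
    nlinarith [norm_nonneg (g 0)]
  have hder : ∀ k : ℕ, 2 ≤ k → iteratedDeriv k g 0 = 0 := by
    intro k hk
    set C := (200 + 3 * ‖g 0‖) with hC
    have hC0 : 0 ≤ C := by positivity
    have hb : ∀ m : ℕ, 1 ≤ m → ‖iteratedDeriv k g 0‖ ≤ k.factorial * C * (1 / Real.sqrt m) := by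
      intro m hm
      have hm' : (1:ℝ) ≤ m := by exact_mod_cast hm
      refine (norm_iteratedDeriv_le_of_forall_mem_sphere_norm_le k (by linarith : (0:ℝ) < m)
        hg.diffContOnCl (hB m hm)).trans ?_
      rw [mul_div_assoc, mul_div_assoc, mul_assoc]
      refine mul_le_mul_of_nonneg_left (mul_le_mul_of_nonneg_left ?_ hC0) (by positivity)
      have hq : 0 < Real.sqrt m := by positivity
      rw [div_le_div_iff₀ (by positivity) hq, mul_assoc, Real.mul_self_sqrt (by positivity), one_mul,
        ← pow_two]
      exact pow_le_pow_right₀ hm' hk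
    have ht : Tendsto (fun m : ℕ => k.factorial * C * (1 / Real.sqrt m)) atTop (𝓝 0) := by
      have : Tendsto (fun m : ℕ => 1 / Real.sqrt m) atTop (𝓝 0) := by
        simp_rw [one_div]
        exact tendsto_inv_atTop_zero.comp (Real.tendsto_sqrt_atTop.comp tendsto_natCast_atTop_atTop)
      simpa using this.const_mul (k.factorial * C)
    have := ge_of_tendsto ht (eventually_atTop.2 ⟨1, hb⟩)
    exact norm_le_zero_iff.1 this
  have haff : ∀ z, g z = g 0 + deriv g 0 * z := by
    intro z
    have h := taylorSeries_eq_of_entire hg 0 z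
    rw [← h, tsum_eq_sum (s := Finset.range 2)]
    · simp [Finset.sum_range_succ, mul_comm]
    · intro k hk
      simp only [Finset.mem_range, not_lt] at hk
      simp [hder k hk]
  set b := deriv g 0
  have hsy : ∀ z, cexp (2 * b * z) = cexp b := by
    intro z
    have h := xiF_symm z
    rw [hfg, hfg, haff, haff z, Complex.exp_add, Complex.exp_add] at h
    have h := mul_left_cancel₀ (Complex.exp_ne_zero _) h
    calc cexp (2 * b * z) = cexp (b * z) * cexp (b * z) := by rw [← Complex.exp_add]; ring_nf
      _ = cexp (b * (1 - z)) * cexp (b * z) := by rw [h]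
      _ = _ := by rw [← Complex.exp_add]; ring_nf
  have hb : b = 0 := by
    have h1 : HasDerivAt (fun z : ℂ => cexp (2 * b * z)) (cexp (2 * b * 0) * (2 * b * 1)) 0 :=
      ((hasDerivAt_id (0:ℂ)).const_mul (2 * b)).cexp
    have h2 : HasDerivAt (fun z : ℂ => cexp (2 * b * z)) 0 0 := by
      simp_rw [hsy]; exact hasDerivAt_const _ _
    have := h1.unique h2
    simpa using this
  have hc : xiF 2 = xiF 0 := by
    rw [hfg, hfg, haff, hb]; simp
  have h2 : completedRiemannZeta₀ 2 = 0 := by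
    simp only [xiF] at hc
    norm_num at hc
    exact hc
  have h3 := riemannZeta_def_of_ne_zero (two_ne_zero : (2:ℂ) ≠ 0)
  rw [completedRiemannZeta_eq, h2, riemannZeta_two, Gammaℝ_def] at h3
  norm_num [Complex.cpow_neg] at h3
  have h4 : ((Real.pi : ℝ) : ℂ) = 3 := by
    have hp : ((Real.pi : ℝ) : ℂ) ≠ 0 := by exact_mod_cast Real.pi_ne_zero
    field_simp at h3
    linear_combination h3 / 2
  have : Real.pi = 3 := by exact_mod_cast h4
  linarith [Real.pi_gt_three]

/-- A nontrivial zero exists with real part at least one half. -/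
lemma exists_zero_half : ∃ s : ℂ, riemannZeta s = 0 ∧ 1 / 2 ≤ s.re := by
  have key : ∀ s, xiF s = 0 → 1 / 2 ≤ s.re → riemannZeta s = 0 := by
    intro s hs hre
    have h0 : s ≠ 0 := by rintro rfl; norm_num at hre
    have h1 : 1 - s ≠ 0 := by
      intro h; simp [xiF, h] at hs
    rw [riemannZeta_def_of_ne_zero h0, completedRiemannZeta_eq]
    have : completedRiemannZeta₀ s - 1 / s - 1 / (1 - s) = xiF s / (s * (1 - s)) := by
      unfold xiF; field_simp; ring
    rw [this, hs]; simp
  obtain ⟨s, hs⟩ := exists_xiF_zero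
  rcases le_total (1/2) s.re with h | h
  · exact ⟨s, key s hs h, h⟩
  · have h' : 1 / 2 ≤ (1 - s).re := by simp only [sub_re, one_re]; linarith
    exact ⟨1 - s, key _ (by rw [xiF_symm, hs]) h', h'⟩

end ZetaOmega

namespace ZetaOmega
open ProbabilityTheory Topology

lemma landau_step {Ω : Type*} [MeasurableSpace Ω] {μ : Measure Ω} {X : Ω → ℝ}
    (hXm : Measurable X) (hX : ∀ᵐ w ∂μ, X w ≤ 0) (F : ℝ → ℝ) (a r : ℝ) (hr : 0 < r)
    (p : FormalMultilinearSeries ℝ ℝ ℝ) (R : ENNReal) (hp : HasFPowerSeriesOnBall F p a R)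
    (hrR : ENNReal.ofReal r < R)
    (ha : a ∈ interior (integrableExpSet X μ)) (hF : F =ᶠ[𝓝 a] mgf X μ) :
    a - r ∈ integrableExpSet X μ := by
  have hpow := hasFPowerSeriesAt_mgf ha
  have hpe : p = _ := (hp.hasFPowerSeriesAt.congr hF).eq_formalMultilinearSeries hpow
  have hmem : (-r) ∈ Metric.eball (0:ℝ) R := by
    simpa [Metric.mem_eball, edist_dist, abs_of_pos hr] using hrR
  have hs := hp.hasSum hmem
  rw [hpe] at hs
  have hs : Summable (fun n : ℕ => (-r) ^ n * ((∫ w, X w ^ n * Real.exp (a * X w) ∂μ) / n.factorial)) := by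
    refine hs.summable.congr fun n => ?_
    simp [FormalMultilinearSeries.ofScalars_apply_eq, mul_comm]
  -- nonnegative functions
  set f : ℕ → Ω → ℝ := fun n w => (-r * X w) ^ n / n.factorial * Real.exp (a * X w) with hf
  have hfm : ∀ n, Measurable (f n) := by intro n; fun_prop
  have hf0 : ∀ n, 0 ≤ᵐ[μ] f n := by
    intro n
    filter_upwards [hX] with w hw
    have : 0 ≤ -r * X w := by nlinarith
    simp only [hf, Pi.zero_apply]; positivity
  have hfi : ∀ n, Integrable (f n) μ := by
    intro n
    have := integrable_pow_mul_exp_of_mem_interior_integrableExpSet ha n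
    convert! this.const_mul ((-r) ^ n / n.factorial) using 1
    ext w; simp only [hf, mul_pow]; ring
  have hIntgr : ∀ n, ∫ w, f n w ∂μ =
      (-r) ^ n * ((∫ w, X w ^ n * Real.exp (a * X w) ∂μ) / n.factorial) := by
    intro n
    rw [mul_div_left_comm, ← mul_comm, mul_comm, mul_comm _ ((-r) ^ n / _), ← integral_const_mul]
    congr 1; ext w; simp only [hf, mul_pow]; ring
  have hsum : ∀ w, HasSum (fun n => f n w) (Real.exp ((a - r) * X w)) := by
    intro w
    have := (NormedSpace.expSeries_div_hasSum_exp (-r * X w)).mul_right (Real.exp (a * X w))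
    rw [← Real.exp_eq_exp_ℝ, ← Real.exp_add] at this
    convert! this using 2; ring
  show Integrable _ μ
  refine ⟨by fun_prop, ?_⟩
  rw [hasFiniteIntegral_iff_ofReal (ae_of_all _ fun w => (Real.exp_pos _).le)]
  have e : ∀ᵐ w ∂μ, ENNReal.ofReal (Real.exp ((a - r) * X w)) = ∑' n, ENNReal.ofReal (f n w) := by
    filter_upwards [ae_all_iff.2 hf0] with w hw
    rw [← (hsum w).tsum_eq, ENNReal.ofReal_tsum_of_nonneg hw (hsum w).summable]
  rw [lintegral_congr_ae e, lintegral_tsum (fun n => (hfm n).ennreal_ofReal.aemeasurable)]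
  have e2 : ∀ n, ∫⁻ w, ENNReal.ofReal (f n w) ∂μ = ENNReal.ofReal (∫ w, f n w ∂μ) := fun n =>
    (ofReal_integral_eq_lintegral_ofReal (hfi n) (hf0 n)).symm
  simp_rw [e2, hIntgr]
  rw [← ENNReal.ofReal_tsum_of_nonneg _ hs]
  · exact ENNReal.ofReal_lt_top
  · intro n; rw [← hIntgr]; exact integral_nonneg_of_ae (hf0 n)

lemma landau {Ω : Type*} [MeasurableSpace Ω] {μ : Measure Ω} {X : Ω → ℝ}
    (hXm : Measurable X) (hX : ∀ᵐ w ∂μ, X w ≤ 0) (F : ℝ → ℝ) (θ b : ℝ)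
    (hb : ∀ t, b < t → t ∈ integrableExpSet X μ) (hFb : ∀ t, b < t → F t = mgf X μ t)
    (hF : ∀ t, θ < t → AnalyticAt ℝ F t) : ∀ t, θ < t → t ∈ integrableExpSet X μ := by
  set S := integrableExpSet X μ with hS
  have hup : ∀ t ∈ S, ∀ u, t ≤ u → u ∈ S := by
    intro t ht u htu
    refine Integrable.mono' (g := fun w => Real.exp (t * X w)) ht (by fun_prop) ?_
    filter_upwards [hX] with w hw
    rw [Real.norm_of_nonneg (Real.exp_pos _).le]
    exact Real.exp_le_exp.2 (by nlinarith)
  by_contra hcon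
  push Not at hcon
  obtain ⟨t₀, ht₀, hnot⟩ := hcon
  have hlb : ∀ u ∈ S, t₀ < u := fun u hu => by
    by_contra h; exact hnot (hup u hu _ (not_lt.1 h))
  have hne : S.Nonempty := ⟨b + 1, hb _ (by linarith)⟩
  have hbdd : BddBelow S := ⟨t₀, fun u hu => (hlb u hu).le⟩
  set σ := sInf S with hσ
  have hσt : t₀ ≤ σ := le_csInf hne fun u hu => (hlb u hu).le
  have hIoi : Set.Ioi σ ⊆ S := by
    intro u hu
    obtain ⟨v, hv, hvu⟩ := exists_lt_of_csInf_lt hne hu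
    exact hup v hv u hvu.le
  have hIntgr : Set.Ioi σ ⊆ interior S := interior_maximal hIoi isOpen_Ioi
  have heq : Set.EqOn F (mgf X μ) (Set.Ioi σ) := by
    set t1 := max b σ + 1
    have h1 : b < t1 := by have := le_max_left b σ; simp only [t1]; linarith
    have h2 : σ < t1 := by have := le_max_right b σ; simp only [t1]; linarith
    refine AnalyticOnNhd.eqOn_of_preconnected_of_eventuallyEq (z₀ := t1)
      (fun u hu => hF u ?_) (fun u hu => analyticAt_mgf (hIntgr hu)) isPreconnected_Ioi h2 ?_
    · have : σ < u := hu
      linarith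
    · filter_upwards [lt_mem_nhds h1] with u hu using hFb u hu
  obtain ⟨p, R, hp⟩ := hF σ (lt_of_lt_of_le ht₀ hσt)
  obtain ⟨ρ, hρ0, hρR⟩ : ∃ ρ : ℝ, 0 < ρ ∧ ENNReal.ofReal (4 * ρ) < R := by
    obtain ⟨q, hq0, hqR⟩ := ENNReal.lt_iff_exists_nnreal_btwn.1 hp.r_pos
    have : (0:ℝ) < q := by exact_mod_cast hq0
    refine ⟨q / 4, by positivity, ?_⟩
    have e : 4 * ((q:ℝ) / 4) = q := by ring
    rw [e, ENNReal.ofReal_coe_nnreal]; exact hqR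
  have hnn : ((‖ρ‖₊ : NNReal) : ENNReal) = ENNReal.ofReal ρ := by
    rw [← enorm_eq_nnnorm, ← ofReal_norm, Real.norm_of_nonneg hρ0.le]
  have hch := hp.changeOrigin (y := ρ) (by
    refine lt_of_le_of_lt ?_ hρR
    rw [hnn]
    exact ENNReal.ofReal_le_ofReal (by linarith))
  have hin : σ + ρ ∈ interior S := hIntgr (by simp [hρ0])
  have := landau_step hXm hX F (σ + ρ) (2 * ρ) (by positivity) _ _ hch (by
    rw [lt_tsub_iff_right]
    rw [hnn, ← ENNReal.ofReal_add (by positivity) hρ0.le]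
    refine lt_of_le_of_lt ?_ hρR
    exact ENNReal.ofReal_le_ofReal (by linarith)) hin
    (by filter_upwards [lt_mem_nhds (show σ < σ + ρ by linarith)] with u hu using heq hu)
  have := csInf_le hbdd this
  linarith

end ZetaOmega

namespace ZetaOmega
open Complex Topology

lemma tail_aux (f : ℝ → ℝ) (a p C : ℝ) (ha : 0 < a) (hf : Measurable f)
    (hb : ∀ t, a < t → |f t| ≤ C * t ^ p) (z : ℂ) (hz : p < z.re) :
    IntegrableOn (fun t : ℝ => (f t : ℂ) * (t:ℂ) ^ (-(z + 1))) (Set.Ioi a) ∧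
    DifferentiableAt ℂ (fun z : ℂ => ∫ t in Set.Ioi a, (f t : ℂ) * (t:ℂ) ^ (-(z + 1))) z := by
  set g : ℝ → ℂ := (Set.Ioi a).indicator (fun t => (f t : ℂ)) with hg
  have hgm : Measurable g := (measurable_ofReal.comp hf).indicator measurableSet_Ioi
  have hC : 0 ≤ C := by
    have := (abs_nonneg _).trans (hb (a+1) (by linarith))
    have h2 : 0 < (a+1) ^ p := by positivity
    nlinarith
  have hgb : ∀ t, 0 < t → ‖g t‖ ≤ C * t ^ p := by
    intro t ht
    by_cases h : a < t
    · rw [hg, Set.indicator_of_mem (by exact h)]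
      simpa using hb t h
    · rw [hg, Set.indicator_of_notMem (by exact h)]
      simp only [norm_zero]; positivity
  have hloc : LocallyIntegrableOn g (Set.Ioi 0) := by
    have : LocallyIntegrableOn (fun t : ℝ => C * t ^ p) (Set.Ioi 0) := by
      refine ContinuousOn.locallyIntegrableOn ?_ measurableSet_Ioi
      refine continuousOn_const.mul fun t ht => ?_
      exact (Real.continuousAt_rpow_const _ _ (Or.inl (ne_of_gt ht))).continuousWithinAt
    intro x hx
    obtain ⟨s, hs, hi⟩ := this x hx
    refine ⟨s ∩ Set.Ioi 0, inter_mem hs self_mem_nhdsWithin, ?_⟩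
    refine Integrable.mono' (hi.mono_set Set.inter_subset_left) hgm.aestronglyMeasurable ?_
    have hle : volume.restrict (s ∩ Set.Ioi 0) ≤ volume.restrict (Set.Ioi (0:ℝ)) :=
      Measure.restrict_mono Set.inter_subset_right le_rfl
    refine ae_mono hle ?_
    filter_upwards [ae_restrict_mem measurableSet_Ioi] with t ht using hgb t ht
  have htop : g =O[atTop] fun t : ℝ => t ^ (-(-p)) := by
    refine Asymptotics.IsBigO.of_bound C ?_
    filter_upwards [eventually_gt_atTop 0] with t ht
    rw [neg_neg, Real.norm_of_nonneg (by positivity)]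
    exact hgb t ht
  have hbot : ∀ b : ℝ, g =O[𝓝[>] 0] fun t : ℝ => t ^ (-b) := by
    intro b
    refine Asymptotics.IsBigO.of_bound 1 ?_
    filter_upwards [mem_nhdsWithin_of_mem_nhds (gt_mem_nhds ha)] with t ht
    rw [hg, Set.indicator_of_notMem (by simpa using ht.le)]
    simp
  have hfun : ∀ w : ℂ, (fun t : ℝ => (t:ℂ) ^ (-w - 1) • g t) =
      (Set.Ioi a).indicator (fun t : ℝ => (f t : ℂ) * (t:ℂ) ^ (-(w + 1))) := by
    intro w
    ext t
    by_cases h : t ∈ Set.Ioi a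
    · rw [hg, Set.indicator_of_mem h, Set.indicator_of_mem h, smul_eq_mul, mul_comm, neg_add']
    · rw [hg, Set.indicator_of_notMem h, Set.indicator_of_notMem h, smul_zero]
  have hIntgr : Set.Ioi (0:ℝ) ∩ Set.Ioi a = Set.Ioi a :=
    Set.inter_eq_right.2 (Set.Ioi_subset_Ioi ha.le)
  have hmel : (fun z : ℂ => ∫ t in Set.Ioi a, (f t : ℂ) * (t:ℂ) ^ (-(z + 1))) =
      fun z => mellin g (-z) := by
    ext w
    rw [mellin, hfun w, setIntegral_indicator measurableSet_Ioi, hIntgr]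
  constructor
  · have := mellinConvergent_of_isBigO_rpow (s := -z) hloc htop (by simpa using hz)
      (hbot ((-z).re - 1)) (by linarith)
    rw [MellinConvergent, hfun z, integrableOn_indicator_iff measurableSet_Ioi, Set.inter_comm, hIntgr] at this
    exact this
  · rw [hmel]
    have := mellin_differentiableAt_of_isBigO_rpow (s := -z) hloc htop (by simpa using hz)
      (hbot ((-z).re - 1)) (by linarith)
    exact this.comp z differentiableAt_id.neg

lemma integral_cpow_aux {a : ℝ} (ha : 0 < a) {z : ℂ} (hz : 1 < z.re) :
    ∫ t in Set.Ioi a, (t:ℂ) * (t:ℂ) ^ (-(z + 1)) = (a:ℂ) ^ (1 - z) / (z - 1) := by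
  have h1 : ∫ t in Set.Ioi a, (t:ℂ) * (t:ℂ) ^ (-(z + 1)) = ∫ t in Set.Ioi a, (t:ℂ) ^ (-z) := by
    refine setIntegral_congr_fun measurableSet_Ioi fun t ht => ?_
    have ht0 : (t:ℂ) ≠ 0 := by exact_mod_cast (ha.trans ht).ne'
    nth_rewrite 1 [← cpow_one (t:ℂ)]
    rw [← cpow_add _ _ ht0]; congr 1; ring
  rw [h1, integral_Ioi_cpow_of_lt (by simpa using hz) ha]
  rw [show -z + 1 = -(z - 1) by ring, show (-(z-1)) = 1 - z by ring, show z - 1 = -(1 - z) by ring, div_neg, neg_div]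

lemma zeta_floor {z : ℂ} (hz : 1 < z.re) :
    riemannZeta z = z * ∫ t in Set.Ioi (1:ℝ), (⌊t⌋₊ : ℂ) * (t:ℂ) ^ (-(z + 1)) := by
  have h := LSeries_eq_mul_integral_of_nonneg (fun _ => (1:ℝ)) (r := 1) zero_le_one hz
    (by simpa using Asymptotics.isBigO_refl _ _) (by simp)
  have e : (fun n : ℕ => ((1:ℝ):ℂ)) = 1 := by ext; simp
  rw [e, LSeries_one_eq_riemannZeta hz] at h
  rw [h]
  simp

lemma zeta1_fract {z : ℂ} (hz : 0 < z.re) :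
    riemannZeta₁ z = z - z * (z - 1) * ∫ t in Set.Ioi (1:ℝ), ((Int.fract t : ℝ) : ℂ) * (t:ℂ) ^ (-(z + 1)) := by
  have hb : ∀ t : ℝ, 1 < t → |Int.fract t| ≤ 1 * t ^ (0:ℝ) := by
    intro t _
    rw [Real.rpow_zero, abs_of_nonneg (Int.fract_nonneg t)]
    linarith [Int.fract_lt_one t]
  have hbt : ∀ t : ℝ, 1 < t → |t| ≤ 1 * t ^ (1:ℝ) := by
    intro t h
    rw [Real.rpow_one, abs_of_pos (by linarith)]; linarith
  have hT := fun z hz => tail_aux (fun t => Int.fract t) 1 0 1 one_pos measurable_fract hb z hz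
  have key : Set.EqOn riemannZeta₁ (fun z : ℂ => z - z * (z - 1) *
      ∫ t in Set.Ioi (1:ℝ), ((Int.fract t : ℝ) : ℂ) * (t:ℂ) ^ (-(z + 1))) {z : ℂ | 0 < z.re} := by
    have hop : IsOpen {z : ℂ | 0 < z.re} := isOpen_lt continuous_const continuous_re
    refine AnalyticOnNhd.eqOn_of_preconnected_of_eventuallyEq (z₀ := 2)
      (differentiable_riemannZeta₁.differentiableOn.analyticOnNhd hop)
      (DifferentiableOn.analyticOnNhd (fun w hw => ?_) hop)
      (convex_halfSpace_re_gt 0).isPreconnected (by simp) ?_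
    · have h := (hT w hw).2
      exact (differentiableAt_id.sub ((differentiableAt_id.mul
        (differentiableAt_id.sub_const 1)).mul h)).differentiableWithinAt
    · have : {z : ℂ | 1 < z.re} ∈ 𝓝 (2:ℂ) :=
        (isOpen_lt continuous_const continuous_re).mem_nhds (by simp)
      filter_upwards [this] with w hw
      have hw1 : w ≠ 1 := by rintro rfl; simp at hw
      have hw1' : w - 1 ≠ 0 := sub_ne_zero.2 hw1
      have hz := zeta_floor hw
      have hsplit : ∫ t in Set.Ioi (1:ℝ), (⌊t⌋₊ : ℂ) * (t:ℂ) ^ (-(w + 1)) =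
          (∫ t in Set.Ioi (1:ℝ), (t:ℂ) * (t:ℂ) ^ (-(w + 1))) -
          ∫ t in Set.Ioi (1:ℝ), ((Int.fract t : ℝ) : ℂ) * (t:ℂ) ^ (-(w + 1)) := by
        rw [← integral_sub (tail_aux (fun t => t) 1 1 1 one_pos measurable_id hbt w hw).1
          (hT w (lt_trans zero_lt_one hw)).1]
        refine setIntegral_congr_fun measurableSet_Ioi fun t ht => ?_
        have ht0 : (0:ℝ) ≤ t := le_trans zero_le_one (le_of_lt ht)
        have : ((⌊t⌋₊ : ℝ)) = t - Int.fract t := by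
          rw [natCast_floor_eq_intCast_floor ht0, Int.self_sub_fract]
        have h2 : (⌊t⌋₊ : ℂ) = (t:ℂ) - (Int.fract t : ℝ) := by
          rw [← ofReal_sub, ← this]; simp
        simp only [h2]; ring
      rw [hsplit, integral_cpow_aux one_pos hw, riemannZeta_eq_inv_sub_mul hw1] at hz
      simp only [ofReal_one, one_cpow] at hz
      have : riemannZeta₁ w = (w - 1) * ((w - 1)⁻¹ * riemannZeta₁ w) := by field_simp
      rw [this, hz]
      field_simp
  exact key hz

lemma zeta1_ne_zero_of_real {σ : ℝ} (hσ : 0 < σ) : riemannZeta₁ (σ : ℂ) ≠ 0 := by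
  rcases lt_trichotomy σ 1 with h | h | h
  · rw [zeta1_fract (by simpa using hσ)]
    have e : ∫ t in Set.Ioi (1:ℝ), ((Int.fract t : ℝ) : ℂ) * (t:ℂ) ^ (-((σ:ℂ) + 1)) =
        ((∫ t in Set.Ioi (1:ℝ), Int.fract t * t ^ (-(σ + 1)) : ℝ) : ℂ) := by
      rw [← integral_complex_ofReal]
      refine setIntegral_congr_fun measurableSet_Ioi fun t ht => ?_
      have ht0 : (0:ℝ) ≤ t := le_trans zero_le_one (le_of_lt ht)
      simp only [ofReal_mul, ofReal_cpow ht0]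
      simp
    have hn : 0 ≤ ∫ t in Set.Ioi (1:ℝ), Int.fract t * t ^ (-(σ + 1)) := by
      refine setIntegral_nonneg measurableSet_Ioi fun t ht => ?_
      have ht0 : (0:ℝ) ≤ t := le_trans zero_le_one (le_of_lt ht)
      exact mul_nonneg (Int.fract_nonneg t) (Real.rpow_nonneg ht0 _)
    rw [e]
    set I := ∫ t in Set.Ioi (1:ℝ), Int.fract t * t ^ (-(σ + 1))
    have : (σ:ℂ) - σ * (σ - 1) * (I:ℂ) = ((σ - σ * (σ - 1) * I : ℝ) : ℂ) := by push_cast; ring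
    rw [this, Ne, ofReal_eq_zero]
    have : 0 ≤ σ * (1 - σ) * I := mul_nonneg (mul_nonneg hσ.le (by linarith)) hn
    nlinarith
  · subst h; simp [riemannZeta₁_one]
  · intro h0
    have h1 : (σ:ℂ) ≠ 1 := by exact_mod_cast h.ne'
    refine riemannZeta_ne_zero_of_one_le_re (s := (σ:ℂ)) (by simpa using h.le) ?_
    rw [riemannZeta_eq_inv_sub_mul h1, h0, mul_zero]

end ZetaOmega

namespace ZetaOmega
open Complex Topology

lemma psi_eq (x : ℝ) : psi x = Chebyshev.psi x := by
  rw [Chebyshev.psi_eq_sum_Icc, psi]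
  refine Finset.sum_subset (Finset.Icc_subset_Icc_left zero_le_one) fun n hn hn' => ?_
  have : n = 0 := by
    simp only [Finset.mem_Icc] at hn hn'; omega
  simp [this]

lemma measurable_psi : Measurable psi := by
  rw [show psi = Chebyshev.psi from funext psi_eq]
  exact Chebyshev.psi_mono.measurable

lemma exists_E_bound : ∃ C : ℝ, 0 < C ∧ ∀ t : ℝ, 0 < t → |psi t - t| ≤ C * t := by
  refine ⟨Real.log 4 + 4, by have := Real.log_pos (show (1:ℝ) < 4 by norm_num); linarith, fun t ht => ?_⟩
  have h1 := Chebyshev.psi_le_const_mul_self ht.le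
  have h2 := Chebyshev.psi_nonneg t
  have h3 := Real.log_pos (show (1:ℝ) < 4 by norm_num)
  rw [psi_eq, abs_le]
  constructor
  · nlinarith
  · linarith

noncomputable def Dfun : ℂ → ℂ := dslope (fun z : ℂ => 1 / z - (2:ℂ) ^ (1 - z)) 1

lemma Dfun_diff : DifferentiableOn ℂ Dfun {z : ℂ | 0 < z.re} := by
  have hop : IsOpen {z : ℂ | 0 < z.re} := isOpen_lt continuous_const continuous_re
  rw [Dfun, Complex.differentiableOn_dslope (hop.mem_nhds (by simp))]
  intro z hz
  have hz0 : z ≠ 0 := by rintro rfl; simp at hz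
  refine DifferentiableAt.differentiableWithinAt ?_
  refine DifferentiableAt.sub ((differentiableAt_const _).div differentiableAt_id hz0) ?_
  exact DifferentiableAt.const_cpow (by fun_prop) (Or.inl two_ne_zero)

lemma Dfun_eq {z : ℂ} (hz : z ≠ 1) : Dfun z = (1 / z - (2:ℂ) ^ (1 - z)) / (z - 1) := by
  rw [Dfun, dslope_of_ne _ hz, slope_def_field]
  simp

lemma mellin_E {z : ℂ} (hz : 1 < z.re) :
    ∫ t in Set.Ioi (2:ℝ), ((psi t - t : ℝ) : ℂ) * (t:ℂ) ^ (-(z + 1)) =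
      -(deriv riemannZeta₁ z / (z * riemannZeta₁ z)) + Dfun z := by
  have hz1 : z ≠ 1 := by rintro rfl; simp at hz
  have hz1' : z - 1 ≠ 0 := sub_ne_zero.2 hz1
  have hz0 : z ≠ 0 := by rintro rfl; simp at hz; linarith
  have hze : riemannZeta z ≠ 0 := riemannZeta_ne_zero_of_one_le_re hz.le
  have hW : riemannZeta₁ z ≠ 0 := by
    intro h; apply hze; rw [riemannZeta_eq_inv_sub_mul hz1, h, mul_zero]
  have hpb : ∀ t : ℝ, 2 < t → |psi t| ≤ (Real.log 4 + 4) * t ^ (1:ℝ) := by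
    intro t ht
    rw [Real.rpow_one, psi_eq, abs_of_nonneg (Chebyshev.psi_nonneg t)]
    exact Chebyshev.psi_le_const_mul_self (by linarith)
  have hbt : ∀ t : ℝ, 2 < t → |t| ≤ 1 * t ^ (1:ℝ) := by
    intro t h
    rw [Real.rpow_one, abs_of_pos (by linarith)]; linarith
  have h := LSeries_eq_mul_integral_of_nonneg (fun n => ArithmeticFunction.vonMangoldt n) (r := 1) zero_le_one hz
    (by
      refine Asymptotics.IsBigO.of_bound (Real.log 4 + 4) (Eventually.of_forall fun n => ?_)
      have e : ∑ k ∈ Finset.Icc 1 n, ArithmeticFunction.vonMangoldt k = Chebyshev.psi (n:ℝ) := by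
        rw [← psi_eq, psi, Nat.floor_natCast]
      rw [e, Real.rpow_one, Real.norm_of_nonneg (Chebyshev.psi_nonneg _), Real.norm_of_nonneg (Nat.cast_nonneg n)]
      exact Chebyshev.psi_le_const_mul_self (Nat.cast_nonneg n))
    (fun n => ArithmeticFunction.vonMangoldt_nonneg)
  have e1 : ∀ t : ℝ, (∑ k ∈ Finset.Icc 1 ⌊t⌋₊, ((ArithmeticFunction.vonMangoldt k : ℝ) : ℂ)) = ((psi t : ℝ) : ℂ) := by
    intro t; rw [psi]; push_cast; rfl
  simp only [e1] at h
  have e2 : ∫ t in Set.Ioi (1:ℝ), ((psi t : ℝ) : ℂ) * (t:ℂ) ^ (-(z + 1)) =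
      ∫ t in Set.Ioi (2:ℝ), ((psi t : ℝ) : ℂ) * (t:ℂ) ^ (-(z + 1)) := by
    rw [← integral_indicator measurableSet_Ioi, ← integral_Ici_eq_integral_Ioi, ← integral_indicator measurableSet_Ici]
    congr 1
    ext t
    by_cases h2 : t < 2
    · have : psi t = 0 := by rw [psi_eq, Chebyshev.psi_eq_zero_of_lt_two h2]
      simp [Set.indicator, this]
    · have h2' : 2 ≤ t := not_lt.1 h2
      have h1' : 1 < t := by linarith
      simp [Set.indicator, h2', h1']
  rw [ArithmeticFunction.LSeries_vonMangoldt_eq_deriv_riemannZeta_div hz, e2] at h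
  have e3 : ∫ t in Set.Ioi (2:ℝ), ((psi t - t : ℝ) : ℂ) * (t:ℂ) ^ (-(z + 1)) =
      (∫ t in Set.Ioi (2:ℝ), ((psi t : ℝ) : ℂ) * (t:ℂ) ^ (-(z + 1))) -
      ∫ t in Set.Ioi (2:ℝ), (t : ℂ) * (t:ℂ) ^ (-(z + 1)) := by
    rw [← integral_sub (tail_aux psi 2 1 _ two_pos measurable_psi hpb z hz).1
      (tail_aux (fun t => t) 2 1 1 two_pos measurable_id hbt z hz).1]
    congr 1
    ext t; push_cast; ring
  have e4 := integral_cpow_aux (a := 2) two_pos hz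
  rw [ofReal_ofNat] at e4
  rw [e3, e4, Dfun_eq hz1]
  have e5 : (∫ t in Set.Ioi (2:ℝ), ((psi t : ℝ) : ℂ) * (t:ℂ) ^ (-(z + 1))) =
      (-deriv riemannZeta z / riemannZeta z) / z := by
    rw [h]; field_simp
  rw [e5, deriv_riemannZeta_eq_neg_inv_sub_sq_mul_add hz1, riemannZeta_eq_inv_sub_mul hz1]
  field_simp
  ring

noncomputable def gE (c : ℝ) : ℝ → ℝ := (Set.Ici 2).indicator fun t => (psi t - t) / t ^ c

noncomputable def GE (c x : ℝ) : ℝ := ∫ t in (2:ℝ)..x, gE c t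

lemma GE_eq {c x : ℝ} (hx : 2 ≤ x) : GE c x = ∫ t in (2:ℝ)..x, (psi t - t) / t ^ c := by
  refine intervalIntegral.integral_congr fun t ht => ?_
  rw [Set.uIcc_of_le hx] at ht
  rw [gE, Set.indicator_of_mem (by exact ht.1)]

lemma measurable_gE (c : ℝ) : Measurable (gE c) := by
  refine Measurable.indicator ?_ measurableSet_Ici
  exact (measurable_psi.sub measurable_id).div (measurable_id.pow_const c)

lemma gE_bound {C : ℝ} (hC : ∀ t : ℝ, 0 < t → |psi t - t| ≤ C * t) (c : ℝ) {t : ℝ} (ht : 2 ≤ t) :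
    |gE c t| ≤ C * t ^ (1 - c) := by
  have ht0 : 0 < t := by linarith
  rw [gE, Set.indicator_of_mem (by exact ht), abs_div, abs_of_pos (Real.rpow_pos_of_pos ht0 c),
    Real.rpow_sub ht0, Real.rpow_one, ← mul_div_assoc]
  gcongr
  exact hC t ht0

lemma gE_intervalIntegrable (c a b : ℝ) : IntervalIntegrable (gE c) volume a b := by
  obtain ⟨C, hC0, hC⟩ := exists_E_bound
  have hcont : Continuous fun t : ℝ => C * (max t 2) ^ (1 - c) := by
    refine continuous_const.mul ?_
    refine Continuous.rpow_const (by fun_prop) fun t => Or.inl ?_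
    have := le_max_right t 2; intro h; linarith
  refine (hcont.intervalIntegrable a b).mono_fun (measurable_gE c).aestronglyMeasurable ?_
  refine Eventually.of_forall fun t => ?_
  have hp : 0 ≤ C * (max t 2) ^ (1 - c) := by positivity
  simp only
  rw [Real.norm_of_nonneg hp, Real.norm_eq_abs]
  by_cases h : 2 ≤ t
  · rw [max_eq_left h]; exact gE_bound hC c h
  · rw [gE, Set.indicator_of_notMem (by exact h)]; simpa using hp

lemma continuous_GE (c : ℝ) : Continuous (GE c) :=
  intervalIntegral.continuous_primitive (gE_intervalIntegrable c) 2

lemma GE_bound {c : ℝ} (hc : c < 2) : ∃ C : ℝ, 0 < C ∧ ∀ x, 2 ≤ x → |GE c x| ≤ C * x ^ (2 - c) := by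
  obtain ⟨C, hC0, hC⟩ := exists_E_bound
  refine ⟨C / (2 - c), div_pos hC0 (by linarith), fun x hx => ?_⟩
  have hi : IntervalIntegrable (fun t : ℝ => C * t ^ (1 - c)) volume 2 x :=
    (intervalIntegral.intervalIntegrable_rpow' (by linarith)).const_mul C
  have h1 : |GE c x| ≤ ∫ t in (2:ℝ)..x, C * t ^ (1 - c) := by
    rw [← Real.norm_eq_abs]
    refine intervalIntegral.norm_integral_le_of_norm_le hx ?_ hi
    refine Eventually.of_forall fun t ht => ?_
    exact gE_bound hC c ht.1.le
  rw [intervalIntegral.integral_const_mul, integral_rpow (Or.inl (by linarith))] at h1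
  refine h1.trans ?_
  rw [show 1 - c + 1 = 2 - c by ring, div_mul_eq_mul_div, ← mul_div_assoc]
  have h2c : 0 < 2 - c := by linarith
  gcongr
  have : (0:ℝ) < 2 ^ (2 - c) := by positivity
  linarith

lemma gE_right_cont (c : ℝ) {x : ℝ} (hx : 2 ≤ x) : ContinuousWithinAt (gE c) (Set.Ioi x) x := by
  have hx0 : 0 < x := by linarith
  have hev : ∀ᶠ t in 𝓝[>] x, gE c t = (psi x - t) / t ^ c := by
    have h1 : ∀ᶠ t in 𝓝[>] x, t < (⌊x⌋₊:ℝ) + 1 :=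
      mem_nhdsWithin_of_mem_nhds (gt_mem_nhds (Nat.lt_floor_add_one x))
    filter_upwards [h1, self_mem_nhdsWithin] with t ht1 ht2
    have ht2 : x < t := ht2
    have hfl : ⌊t⌋₊ = ⌊x⌋₊ := by
      rw [Nat.floor_eq_iff (by linarith)]
      exact ⟨(Nat.floor_le hx0.le).trans ht2.le, ht1⟩
    rw [gE, Set.indicator_of_mem (by simp only [Set.mem_Ici]; linarith), psi, psi, hfl]
  have hx1 : gE c x = (psi x - x) / x ^ c := by
    rw [gE, Set.indicator_of_mem (by exact hx)]
  refine ContinuousWithinAt.congr_of_eventuallyEq ?_ hev hx1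
  refine ContinuousAt.continuousWithinAt ?_
  exact (continuousAt_const.sub continuousAt_id).div (Real.continuousAt_rpow_const _ _ (Or.inl hx0.ne'))
    (Real.rpow_pos_of_pos hx0 c).ne'

lemma GE_deriv (c : ℝ) {x : ℝ} (hx : 2 ≤ x) : HasDerivWithinAt (GE c) (gE c x) (Set.Ioi x) x :=
  (intervalIntegral.integral_hasDerivWithinAt_right (s := Set.Ici x) (t := Set.Ioi x)
    (gE_intervalIntegrable c 2 x)
    ((measurable_gE c).stronglyMeasurable.stronglyMeasurableAtFilter) (gE_right_cont c hx)).mono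
    Set.Ioi_subset_Ici_self

lemma mellin_G {c : ℝ} (hc : c < 2) {s : ℂ} (hs : 2 - c < s.re) :
    s * ∫ x in Set.Ioi (2:ℝ), (GE c x : ℂ) * (x:ℂ) ^ (-(s + 1)) =
      ∫ t in Set.Ioi (2:ℝ), ((psi t - t : ℝ) : ℂ) * (t:ℂ) ^ (-((s + c - 1) + 1)) := by
  have hs0 : s ≠ 0 := by rintro rfl; simp at hs; linarith
  obtain ⟨C, hC0, hC⟩ := GE_bound hc
  obtain ⟨C1, hC10, hC1⟩ := exists_E_bound
  have hi1 := (tail_aux (GE c) 2 (2 - c) C two_pos (continuous_GE c).measurable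
    (fun t ht => hC t ht.le) s hs).1
  have hi2 := (tail_aux (fun t => psi t - t) 2 1 C1 two_pos (measurable_psi.sub measurable_id)
    (fun t ht => by rw [Real.rpow_one]; exact hC1 t (by linarith)) (s + c - 1)
    (by simp; linarith)).1
  have heq : ∀ t : ℝ, 2 ≤ t → ((psi t - t : ℝ) : ℂ) * (t:ℂ) ^ (-((s + c - 1) + 1)) =
      (gE c t : ℂ) * (t:ℂ) ^ (-s) := by
    intro t ht
    have ht0 : 0 < t := by linarith
    have ht0' : (t:ℂ) ≠ 0 := by exact_mod_cast ht0.ne'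
    rw [gE, Set.indicator_of_mem (by exact ht), ofReal_div, ofReal_cpow ht0.le,
      show (-((s + c - 1) + 1)) = -s + -(c:ℂ) by ring, cpow_add _ _ ht0', cpow_neg _ (c:ℂ)]
    ring
  set A : ℝ → ℂ := fun x => (GE c x : ℂ) * (x:ℂ) ^ (-(s + 1)) with hA
  set B : ℝ → ℂ := fun t => ((psi t - t : ℝ) : ℂ) * (t:ℂ) ^ (-((s + c - 1) + 1)) with hB
  set Φ : ℝ → ℂ := fun x => (GE c x : ℂ) * (x:ℂ) ^ (-s) with hΦ
  have hderiv : ∀ x : ℝ, 2 ≤ x → HasDerivWithinAt Φ (B x - s * A x) (Set.Ioi x) x := by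
    intro x hx
    have hx0 : 0 < x := by linarith
    have h1 : HasDerivWithinAt (fun x => (GE c x : ℂ)) (gE c x : ℂ) (Set.Ioi x) x :=
      (GE_deriv c hx).ofReal_comp
    have h2 : HasDerivAt (fun x : ℝ => (x:ℂ) ^ (-s)) (-s * (x:ℂ) ^ (-s - 1)) x := by
      have := hasDerivAt_ofReal_cpow_const' hx0.ne' (r := -s - 1) (by
        intro h; apply hs0; linear_combination -h)
      have h3 := this.const_mul (-s)
      refine (h3.congr_of_eventuallyEq ?_)
      refine Eventually.of_forall fun y => ?_
      simp only [sub_add_cancel]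
      field_simp
    have h3 := h1.mul h2.hasDerivWithinAt
    refine h3.congr_deriv ?_
    rw [hB, hA]
    simp only
    rw [heq x hx, neg_add']
    ring
  have hIntgr : IntegrableOn (fun x => B x - s * A x) (Set.Ioi 2) := hi2.sub (hi1.const_mul s)
  have hT := intervalIntegral_tendsto_integral_Ioi 2 hIntgr tendsto_id
  have hev : ∀ᶠ N : ℝ in atTop, (∫ x in (2:ℝ)..N, (B x - s * A x)) = Φ N := by
    filter_upwards [eventually_ge_atTop 2] with N hN
    rw [intervalIntegral.integral_eq_sub_of_hasDeriv_right_of_le hN (f := Φ)]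
    · simp [hΦ, GE]
    · intro x hx
      have hx0 : 0 < x := by linarith [hx.1]
      refine ContinuousAt.continuousWithinAt ?_
      refine (continuous_ofReal.continuousAt.comp (continuous_GE c).continuousAt).mul ?_
      exact continuousAt_ofReal_cpow_const _ _ (Or.inr hx0.ne')
    · intro x hx
      exact hderiv x hx.1.le
    · rw [intervalIntegrable_iff_integrableOn_Ioc_of_le hN]
      exact hIntgr.mono_set Set.Ioc_subset_Ioi_self
  have hΦ0 : Tendsto Φ atTop (𝓝 0) := by
    have hlim : Tendsto (fun x : ℝ => C * x ^ (-(s.re - (2 - c)))) atTop (𝓝 0) := by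
      simpa using (tendsto_rpow_neg_atTop (show 0 < s.re - (2 - c) by linarith)).const_mul C
    refine squeeze_zero_norm' ?_ hlim
    filter_upwards [eventually_ge_atTop 2] with x hx
    have hx0 : 0 < x := by linarith
    rw [hΦ]
    simp only
    rw [norm_mul, norm_cpow_eq_rpow_re_of_pos hx0, norm_real, Real.norm_eq_abs, neg_re,
      show -(s.re - (2 - c)) = (2 - c) + -s.re by ring, Real.rpow_add hx0, ← mul_assoc]
    gcongr
    exact hC x hx
  have h0 := tendsto_nhds_unique (hT.congr' (by filter_upwards [hev] with N hN using hN)) hΦ0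
  rw [integral_sub hi2 (hi1.const_mul s), integral_const_mul] at h0
  exact (sub_eq_zero.1 h0).symm

end ZetaOmega

namespace ZetaOmega
open Complex Topology ProbabilityTheory

lemma core {c η : ℝ} (hη : 0 < η) (hc : c < 2) (hθ : 0 < 1 + η - c) (σ : ℝ) (hσ : σ ≠ 0)
    (X0 : ℝ) (hX0 : 2 ≤ X0) (h : ∀ x, X0 < x → σ * GE c x ≤ x ^ (1 + η - c)) :
    ∀ ρ : ℂ, η < ρ.re → riemannZeta₁ ρ ≠ 0 := by
  set θ := 1 + η - c with hθdef
  set b := max (2 - c) θ with hb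
  have hb1 : 2 - c ≤ b := le_max_left _ _
  have hb2 : θ ≤ b := le_max_right _ _
  have hX00 : 0 < X0 := by linarith
  obtain ⟨C, hC0, hC⟩ := GE_bound hc
  -- the three pieces
  have hP := fun z hz => tail_aux (fun x => x ^ θ) X0 θ 1 hX00 (measurable_id.pow_const θ)
    (fun t ht => by rw [one_mul, abs_of_nonneg (Real.rpow_nonneg (hX00.trans ht).le _)]) z hz
  have hGX := fun z hz => tail_aux (GE c) X0 (2 - c) C hX00 (continuous_GE c).measurable
    (fun t ht => hC t (hX0.trans ht.le)) z hz
  have hG2 := fun z hz => tail_aux (GE c) 2 (2 - c) C two_pos (continuous_GE c).measurable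
    (fun t ht => hC t ht.le) z hz
  have hH := fun z hz => tail_aux ((Set.Iic X0).indicator (GE c)) 2 0 (C * X0 ^ (2 - c)) two_pos
    ((continuous_GE c).measurable.indicator measurableSet_Iic)
    (fun t ht => by
      rw [Real.rpow_zero, mul_one]
      by_cases ht2 : t ≤ X0
      · rw [Set.indicator_of_mem (by exact ht2)]
        refine (hC t ht.le).trans ?_
        have : t ^ (2 - c) ≤ X0 ^ (2 - c) := Real.rpow_le_rpow (by linarith) ht2 (by linarith)
        gcongr
      · rw [Set.indicator_of_notMem (by exact ht2), abs_zero]; positivity) z hz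
  set P : ℂ → ℂ := fun z => ∫ t in Set.Ioi X0, ((t ^ θ : ℝ) : ℂ) * (t:ℂ) ^ (-(z + 1)) with hPdef
  set H : ℂ → ℂ := fun z => ∫ t in Set.Ioi (2:ℝ), (((Set.Iic X0).indicator (GE c) t : ℝ) : ℂ) * (t:ℂ) ^ (-(z + 1)) with hHdef
  have hsplit : ∀ s : ℂ, b < s.re → ∫ t in Set.Ioi X0, (GE c t : ℂ) * (t:ℂ) ^ (-(s + 1)) =
      (∫ t in Set.Ioi (2:ℝ), (GE c t : ℂ) * (t:ℂ) ^ (-(s + 1))) - H s := by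
    intro s hs
    rw [hHdef]
    simp only
    rw [← integral_sub (hG2 s (by linarith)).1 (hH s (by linarith)).1]
    have hss : Set.Ioi X0 ⊆ Set.Ioi (2:ℝ) := Set.Ioi_subset_Ioi hX0
    rw [← Set.inter_eq_right.2 hss, ← setIntegral_indicator measurableSet_Ioi]
    congr 1
    ext t
    by_cases ht : t ≤ X0
    · rw [Set.indicator_of_notMem (by simpa using ht), Set.indicator_of_mem (by exact ht), sub_self]
    · rw [Set.indicator_of_mem (by simpa using ht), Set.indicator_of_notMem (by exact ht)]
      simp
  -- the measure
  set f : ℝ → ℝ := fun x => x ^ θ - σ * GE c x with hf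
  have hfm : Measurable f :=
    (measurable_id.pow_const θ).sub (measurable_const.mul (continuous_GE c).measurable)
  set d : ℝ → ENNReal := fun x => ENNReal.ofReal (f x * x⁻¹) with hd
  have hdm : Measurable d := (hfm.mul measurable_inv).ennreal_ofReal
  have hdt : ∀ᵐ x ∂(volume.restrict (Set.Ioi X0)), d x < ⊤ :=
    Eventually.of_forall fun x => ENNReal.ofReal_lt_top
  set μ : Measure ℝ := (volume.restrict (Set.Ioi X0)).withDensity d with hμ
  set X : ℝ → ℝ := fun x => -Real.log x with hX
  have hXm : Measurable X := Real.measurable_log.neg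
  have hXn : ∀ᵐ x ∂μ, X x ≤ 0 := by
    refine (withDensity_absolutelyContinuous _ _).ae_le ?_
    filter_upwards [ae_restrict_mem measurableSet_Ioi] with x hx
    have hx : X0 < x := hx
    have := Real.log_nonneg (show 1 ≤ x by linarith)
    simp only [hX]; linarith
  have hpt : ∀ s : ℂ, ∀ x ∈ Set.Ioi X0, (d x).toReal • Complex.exp (s * (X x : ℂ)) =
      ((x ^ θ : ℝ) : ℂ) * (x:ℂ) ^ (-(s + 1)) - σ * ((GE c x : ℂ) * (x:ℂ) ^ (-(s + 1))) := by
    intro s x hx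
    have hx : X0 < x := hx
    have hx0 : 0 < x := by linarith
    have hx0' : (x:ℂ) ≠ 0 := by exact_mod_cast hx0.ne'
    have hfx : 0 ≤ f x := by have := h x hx; simp only [hf]; linarith
    have e1 : (d x).toReal = f x * x⁻¹ := ENNReal.toReal_ofReal (by positivity)
    have e2 : Complex.exp (s * (X x : ℂ)) = (x:ℂ) ^ (-s) := by
      rw [cpow_def_of_ne_zero hx0', ← ofReal_log hx0.le]
      simp only [hX]; push_cast; congr 1; ring
    have e3 : (x:ℂ) ^ (-(s + 1)) = (x:ℂ) ^ (-s) * (x:ℂ)⁻¹ := by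
      rw [neg_add, cpow_add _ _ hx0', cpow_neg_one]
    rw [e1, e2, e3, real_smul]
    simp only [hf]
    push_cast
    ring
  have hintC : ∀ s : ℂ, b < s.re → Integrable (fun x => Complex.exp (s * (X x : ℂ))) μ := by
    intro s hs
    rw [hμ, integrable_withDensity_iff_integrable_smul' hdm hdt]
    have : IntegrableOn (fun x : ℝ => ((x ^ θ : ℝ) : ℂ) * (x:ℂ) ^ (-(s + 1)) -
        σ * ((GE c x : ℂ) * (x:ℂ) ^ (-(s + 1)))) (Set.Ioi X0) :=
      (hP s (by linarith)).1.sub ((hGX s (by linarith)).1.const_mul (σ:ℂ))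
    exact this.congr_fun (fun x hx => (hpt s x hx).symm) measurableSet_Ioi
  have hM : ∀ s : ℂ, b < s.re → complexMGF X μ s =
      P s - σ * ∫ t in Set.Ioi X0, (GE c t : ℂ) * (t:ℂ) ^ (-(s + 1)) := by
    intro s hs
    rw [complexMGF, hμ, integral_withDensity_eq_integral_toReal_smul hdm hdt,
      setIntegral_congr_fun measurableSet_Ioi (hpt s),
      integral_sub (hP s (by linarith)).1 ((hGX s (by linarith)).1.const_mul (σ:ℂ)),
      integral_const_mul]
  set W := riemannZeta₁ with hW
  have hWd : Differentiable ℂ W := differentiable_riemannZeta₁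
  have hWd' : Differentiable ℂ (deriv W) := hWd.deriv
  set R : ℂ → ℂ := fun s => P s + σ * H s -
    σ / s * (-(deriv W (s + c - 1) / ((s + c - 1) * W (s + c - 1))) + Dfun (s + c - 1)) with hR
  have hMR : ∀ s : ℂ, b < s.re → complexMGF X μ s = R s := by
    intro s hs
    have hs0 : s ≠ 0 := by rintro rfl; simp at hs; linarith
    have h1 := mellin_G hc (s := s) (by linarith)
    rw [mellin_E (by simp; linarith)] at h1
    rw [hM s hs, hsplit s hs, hR]
    simp only
    rw [← h1]
    field_simp
    ring
  have hreg : ∀ s : ℂ, θ < s.re → 0 < (s + c - 1).re := by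
    intro s hs; simp; linarith
  have hopθ : IsOpen {s : ℂ | θ < s.re} := isOpen_lt continuous_const continuous_re
  have hop0 : IsOpen {s : ℂ | 0 < s.re} := isOpen_lt continuous_const continuous_re
  have hDd : ∀ s : ℂ, θ < s.re → DifferentiableAt ℂ (fun s : ℂ => Dfun (s + c - 1)) s := by
    intro s hs
    have h1 := (Dfun_diff.differentiableAt (hop0.mem_nhds (hreg s hs)))
    exact DifferentiableAt.comp s h1 (by fun_prop)
  have hRd : ∀ s : ℂ, θ < s.re → W (s + c - 1) ≠ 0 → DifferentiableAt ℂ R s := by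
    intro s hs hws
    have hs0 : s ≠ 0 := by rintro rfl; simp at hs; linarith
    have hz0 : s + c - 1 ≠ 0 := by intro h0; have := hreg s hs; rw [h0] at this; simp at this
    have d1 : DifferentiableAt ℂ P s := (hP s hs).2
    have d2 : DifferentiableAt ℂ H s := (hH s (by linarith)).2
    have d3 : DifferentiableAt ℂ (fun s : ℂ => W (s + c - 1)) s :=
      (hWd _).comp s (by fun_prop)
    have d4 : DifferentiableAt ℂ (fun s : ℂ => deriv W (s + c - 1)) s :=
      (hWd' _).comp s (by fun_prop)
    have d5 : DifferentiableAt ℂ (fun s : ℂ => (s + c - 1) * W (s + c - 1)) s :=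
      DifferentiableAt.mul (by fun_prop) d3
    exact (d1.add (d2.const_mul _)).sub (((differentiableAt_const _).div differentiableAt_id hs0).mul
      ((d4.div d5 (mul_ne_zero hz0 hws)).neg.add (hDd s hs)))
  have hRan : ∀ t : ℝ, θ < t → AnalyticAt ℂ R (t:ℂ) := by
    intro t ht
    have hopW : IsOpen {s : ℂ | W (s + c - 1) ≠ 0} :=
      isOpen_ne_fun (hWd.continuous.comp (by fun_prop)) continuous_const
    refine DifferentiableOn.analyticAt (s := {s : ℂ | θ < s.re} ∩ {s : ℂ | W (s + c - 1) ≠ 0})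
      (fun s hs => (hRd s hs.1 hs.2).differentiableWithinAt) ((hopθ.inter hopW).mem_nhds ⟨by simpa using ht, ?_⟩)
    have := zeta1_ne_zero_of_real (σ := t + c - 1) (by linarith)
    push_cast at this
    exact this
  have hland := landau hXm hXn (fun t : ℝ => (R t).re) θ b
    (fun t ht => by
      have h1 := (hintC (t:ℂ) (by simpa using ht)).re
      refine h1.congr (Eventually.of_forall fun x => ?_)
      simp only [RCLike.re_to_complex]
      rw [← ofReal_mul, exp_ofReal_re])
    (fun t ht => by
      rw [← hMR (t:ℂ) (by simpa using ht), complexMGF_ofReal, ofReal_re])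
    (fun t ht => (hRan t ht).re_ofReal)
  have hMd : ∀ s : ℂ, θ < s.re → DifferentiableAt ℂ (complexMGF X μ) s := by
    intro s hs
    refine (analyticAt_complexMGF ?_).differentiableAt
    exact mem_interior.2 ⟨Set.Ioi θ, fun t ht => hland t ht, isOpen_Ioi, hs⟩
  set B : ℂ → ℂ := fun s => (s + c - 1) * (s * (complexMGF X μ s - P s - σ * H s) / σ + Dfun (s + c - 1)) with hB
  have hBd : ∀ s : ℂ, θ < s.re → DifferentiableAt ℂ B s := by
    intro s hs
    have d1 : DifferentiableAt ℂ P s := (hP s hs).2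
    have d2 : DifferentiableAt ℂ H s := (hH s (by linarith)).2
    exact DifferentiableAt.mul (by fun_prop) (((differentiableAt_id.mul
      (((hMd s hs).sub d1).sub (d2.const_mul _))).div_const _).add (hDd s hs))
  have hsh : Differentiable ℂ (fun s : ℂ => s + c - 1) := by fun_prop
  have key : Set.EqOn (fun s : ℂ => deriv W (s + c - 1)) (fun s => W (s + c - 1) * B s) {s : ℂ | θ < s.re} := by
    refine AnalyticOnNhd.eqOn_of_preconnected_of_eventuallyEq (z₀ := ((b + 1 : ℝ) : ℂ))
      ((hWd'.comp hsh).differentiableOn.analyticOnNhd hopθ)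
      (DifferentiableOn.analyticOnNhd (fun s hs => ?_) hopθ)
      (convex_halfSpace_re_gt θ).isPreconnected (by simp only [Set.mem_ofPred_eq, ofReal_re]; linarith) ?_
    · exact (((hWd.comp hsh) s).mul (hBd s hs)).differentiableWithinAt
    · have : {s : ℂ | b < s.re} ∈ 𝓝 ((b + 1 : ℝ) : ℂ) :=
        (isOpen_lt continuous_const continuous_re).mem_nhds (by simp only [Set.mem_ofPred_eq, ofReal_re]; linarith)
      filter_upwards [this] with s hs
      have hs : b < s.re := hs
      have hs0 : s ≠ 0 := by rintro rfl; simp at hs; linarith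
      have hz0 : s + c - 1 ≠ 0 := by
        intro h0; have := hreg s (by linarith); rw [h0] at this; simp at this
      have hzr : 1 < (s + c - 1).re := by simp; linarith
      have hz1 : s + c - 1 ≠ 1 := by intro h0; rw [h0] at hzr; simp at hzr
      have hWz : W (s + c - 1) ≠ 0 := by
        intro h0
        refine riemannZeta_ne_zero_of_one_le_re hzr.le ?_
        rw [riemannZeta_eq_inv_sub_mul hz1, ← hW, h0, mul_zero]
      have hσ' : (σ:ℂ) ≠ 0 := by exact_mod_cast hσ
      simp only [hB]
      rw [hMR s hs]
      simp only [hR]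
      field_simp
      ring
  intro ρ hρ h0
  set s₀ : ℂ := ρ - c + 1 with hs₀
  have hs₀r : θ < s₀.re := by simp [hs₀]; linarith
  have hBan : AnalyticAt ℂ B s₀ :=
    DifferentiableOn.analyticAt (fun s hs => (hBd s hs).differentiableWithinAt) (hopθ.mem_nhds hs₀r)
  set V : ℂ → ℂ := fun s => W (s + c - 1) with hV
  have hVd : Differentiable ℂ V := hWd.comp hsh
  have hV0 : V s₀ = 0 := by
    simp only [hV, hs₀]; rw [show ρ - c + 1 + c - 1 = ρ by ring]; exact h0
  have hVder : ∀ s, deriv V s = deriv W (s + c - 1) := by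
    intro s
    have h1 := (hWd (s + c - 1)).hasDerivAt
    have h2 : HasDerivAt (fun s : ℂ => s + c - 1) 1 s := ((hasDerivAt_id s).add_const _).sub_const _
    have := (h1.comp s h2).deriv
    rw [mul_one] at this
    exact this
  have hVan : AnalyticAt ℂ V s₀ := hVd.analyticAt s₀
  have hdV : deriv V =ᶠ[𝓝 s₀] V * B := by
    filter_upwards [hopθ.mem_nhds hs₀r] with s hs
    rw [hVder]; exact key hs
  have ho := hVan.analyticOrderAt_deriv_add_one
  rw [analyticOrderAt_congr hdV, analyticOrderAt_mul hVan hBan, hV0] at ho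
  simp only [sub_zero] at ho
  have htop : analyticOrderAt V s₀ = ⊤ := by
    by_contra hne
    obtain ⟨n, hn⟩ := ENat.ne_top_iff_exists.1 hne
    have hle : analyticOrderAt V s₀ + 1 ≤ analyticOrderAt V s₀ := by
      conv_rhs => rw [← ho]
      gcongr
      exact le_self_add
    rw [← hn] at hle
    have : n + 1 ≤ n := by exact_mod_cast hle
    omega
  have hVz : V = fun _ => 0 :=
    AnalyticOnNhd.eq_of_eventuallyEq (fun z _ => hVd.analyticAt z) (fun z _ => analyticAt_const)
      (analyticOrderAt_eq_top.1 htop)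
  have h1 : V (2 - c) = 1 := by
    simp only [hV]; rw [show (2 - (c:ℂ) + c - 1) = 1 by ring]; exact riemannZeta₁_one
  rw [hVz] at h1
  exact zero_ne_one h1

lemma omega_facts : 1 / 2 ≤ omegaZ ∧ ∀ η, 0 < η → η < omegaZ → ∃ ρ : ℂ, η < ρ.re ∧ riemannZeta₁ ρ = 0 := by
  have hbdd : BddAbove {r : ℝ | ∃ s : ℂ, riemannZeta s = 0 ∧ s.re = r} := by
    refine ⟨1, ?_⟩
    rintro r ⟨s, hs, rfl⟩
    by_contra hlt
    exact riemannZeta_ne_zero_of_one_le_re (not_le.1 hlt).le hs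
  obtain ⟨s, hs, hs2⟩ := exists_zero_half
  refine ⟨hs2.trans (le_csSup hbdd ⟨s, hs, rfl⟩), fun η _ hη => ?_⟩
  obtain ⟨r, ⟨ρ, hρ, rfl⟩, hr⟩ := exists_lt_of_lt_csSup (s := {r : ℝ | ∃ s : ℂ, riemannZeta s = 0 ∧ s.re = r})
    ⟨s.re, s, hs, rfl⟩ hη
  refine ⟨ρ, hr, ?_⟩
  have h1 : ρ ≠ 1 := by rintro rfl; exact riemannZeta_one_ne_zero hρ
  rw [riemannZeta_eq_inv_sub_mul h1] at hρ
  exact (mul_eq_zero.1 hρ).resolve_left (inv_ne_zero (sub_ne_zero.2 h1))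

lemma core2 {c : ℝ} (hc : c < 1 + omegaZ) (homega : 1 + omegaZ ≤ 2) {δ : ℝ} (hδ : 0 < δ)
    (σ : ℝ) (hσ : σ ≠ 0) (X : ℝ) : ∃ x, X < x ∧
      x ^ (1 + omegaZ - c - δ) < σ * ∫ t in (2:ℝ)..x, (psi t - t) / t ^ c := by
  by_contra hcon
  push Not at hcon
  obtain ⟨hw, hz⟩ := omega_facts
  set δ' := min δ (min (omegaZ / 2) ((1 + omegaZ - c) / 2)) with hδ'
  have a1 : δ' ≤ δ := min_le_left _ _
  have a2 : δ' ≤ omegaZ / 2 := (min_le_right _ _).trans (min_le_left _ _)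
  have a3 : δ' ≤ (1 + omegaZ - c) / 2 := (min_le_right _ _).trans (min_le_right _ _)
  have a4 : 0 < δ' := lt_min hδ (lt_min (by linarith) (by linarith))
  obtain ⟨ρ, hρ, hρ0⟩ := hz (omegaZ - δ') (by linarith) (by linarith)
  refine core (c := c) (η := omegaZ - δ') (by linarith) (by linarith) (by linarith) σ hσ (max X 2)
    (le_max_right _ _) (fun x hx => ?_) ρ hρ hρ0
  have hx1 : X < x := (le_max_left _ _).trans_lt hx
  have hx2 : 2 < x := (le_max_right _ _).trans_lt hx
  rw [GE_eq hx2.le]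
  refine (hcon x hx1).trans ?_
  exact Real.rpow_le_rpow_of_exponent_le (by linarith) (by linarith)

end ZetaOmega

theorem integral_psi_sub_id_div_rpow_omega_pm
    (c : ℝ) (hc : c < 1 + omegaZ) (homega : 1 + omegaZ ≤ 2) :
    ∀ δ : ℝ, δ > 0 → ∃ K : ℝ, K > 0 ∧
      (∀ X : ℝ, ∃ x : ℝ, x > X ∧
        (∫ t in (2:ℝ)..x, (psi t - t) / t ^ c) > K * x ^ (1 + omegaZ - c - δ)) ∧
      (∀ X : ℝ, ∃ x : ℝ, x > X ∧
        (∫ t in (2:ℝ)..x, (psi t - t) / t ^ c) < -(K * x ^ (1 + omegaZ - c - δ))) := by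
  intro δ hδ
  refine ⟨1, one_pos, fun X => ?_, fun X => ?_⟩
  · obtain ⟨x, hx, h⟩ := ZetaOmega.core2 hc homega hδ 1 one_ne_zero X
    exact ⟨x, hx, by rw [one_mul] at h ⊢; exact h⟩
  · obtain ⟨x, hx, h⟩ := ZetaOmega.core2 hc homega hδ (-1) (by norm_num) X
    exact ⟨x, hx, by linarith⟩
end
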